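/- arXiv:2309.12831 — 4 statements merged into one kernel-verified Lean document; each statement's English description precedes it below -/
import Mathlib

section
/- Let φ : H → GL(m,ℤ) be an integral representation of a finite group H, and suppose that every irreducible subrepresentation of φ over ℂ (i.e., every simple ℂ[H]-submodule of ℂ^m under the action induced by φ) has dimension at most k. Then RF_{ℤ^m, Inv(φ), B_{ℤ^m}} ⪯ log^k. -/
/-- The word ball of radius `r` in an additive group with respect to a finite
(generating) set `S`: sums of at most `r` elements of `S ∪ (-S)`. -/
def addWordBall {A : Type*} [AddGroup A] (S : Finset A) (r : ℝ) : Set A :=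
  {a | ∃ l : List A, (∀ x ∈ l, x ∈ S ∨ -x ∈ S) ∧ (l.length : ℝ) ≤ r ∧ l.sum = a}

/-- The divisibility function `D_{A,P}(a) = min {[A:N] : N ∈ P, a ∉ N}`, with value `∞`
when no such `N` exists (in particular at `a = 0`). -/
noncomputable def addDivFn {A : Type*} [AddGroup A] (P : Set (AddSubgroup A)) (a : A) : ℕ∞ :=
  sInf {n : ℕ∞ | ∃ N ∈ P, a ∉ N ∧ n = (N.index : ℕ∞)}

/-- The residual finiteness growth function
`RF_{A,P,B_A}(r) = max {D_{A,P}(a) : 0 ≠ a ∈ B_A(r)}` (as a real-valued function,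
taking the value `1` on an empty set of elements). -/
noncomputable def addRF {A : Type*} [AddGroup A] (P : Set (AddSubgroup A)) (S : Finset A)
    (r : ℝ) : ℝ :=
  sSup (insert 1 ((fun a => ((addDivFn P a).toNat : ℝ)) '' (addWordBall S r \ {0})))

/-- `f ⪯ g`: there is `C > 0` with `f(r) ≤ C·g(C·r)` for all `r ≥ max {1, 1/C}`. -/
def GrowthLE (f g : ℝ → ℝ) : Prop :=
  ∃ C : ℝ, 0 < C ∧ ∀ r : ℝ, max 1 (1 / C) ≤ r → f r ≤ C * g (C * r)

/-- `f ≈ g`: `f ⪯ g` and `g ⪯ f`. -/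
def GrowthEquiv (f g : ℝ → ℝ) : Prop :=
  GrowthLE f g ∧ GrowthLE g f

/-- The endomorphism of `ℤ^m` given by an integer matrix. -/
def intAct {m : ℕ} (M : Matrix (Fin m) (Fin m) ℤ) : (Fin m → ℤ) →+ (Fin m → ℤ) :=
  M.mulVecLin.toAddMonoidHom

/-- `Inv(φ)`: the finite-index subgroups of `ℤ^m` invariant under the integral
representation `φ : H → GL(m,ℤ)`. -/
def InvSet {H : Type*} [Group H] {m : ℕ}
    (φ : H →* Matrix.GeneralLinearGroup (Fin m) ℤ) : Set (AddSubgroup (Fin m → ℤ)) :=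
  {N | N.FiniteIndex ∧
    ∀ h : H, N.map (intAct ((φ h : Matrix (Fin m) (Fin m) ℤ))) = N}

/-- A `ℂ`-subspace `W ⊆ ℂ^m` is invariant under the (complexified) family of integer
matrices `ρ`. -/
def InvariantC {H : Type*} {m : ℕ} (ρ : H → Matrix (Fin m) (Fin m) ℤ)
    (W : Submodule ℂ (Fin m → ℂ)) : Prop :=
  ∀ h : H, ∀ v ∈ W, ((ρ h).map (Int.cast : ℤ → ℂ)).mulVec v ∈ W

/-- `W` is an irreducible `ℂ`-subrepresentation: nonzero, invariant, and containing
no proper nonzero invariant subspace. -/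
def IsIrredC {H : Type*} {m : ℕ} (ρ : H → Matrix (Fin m) (Fin m) ℤ)
    (W : Submodule ℂ (Fin m → ℂ)) : Prop :=
  W ≠ ⊥ ∧ InvariantC ρ W ∧
    ∀ W' : Submodule ℂ (Fin m → ℂ), W' ≤ W → W' ≠ ⊥ → InvariantC ρ W' → W' = W

/-- A two-sided Capelli polynomial: alternating in `x`, with separating coefficients `u`, `w`. -/
def capelli {R : Type*} [Ring R] {N : ℕ} (u x w : Fin N → R) : R :=
  ∑ σ : Equiv.Perm (Fin N),
    Equiv.Perm.sign σ • (List.ofFn fun t => u t * x (σ t) * w t).prod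

lemma map_capelli {R R' : Type*} [Ring R] [Ring R'] (f : R →+* R') {N : ℕ}
    (u x w : Fin N → R) :
    f (capelli u x w) = capelli (f ∘ u) (f ∘ x) (f ∘ w) := by
  simp only [capelli, map_sum, Units.smul_def, map_zsmul, map_list_prod, List.map_ofFn]
  simp [Function.comp_def]

lemma capelli_eq_zero_of_finrank_lt {F A : Type*} [Field F] [Ring A] [Algebra F A]
    [Module.Finite F A] {N : ℕ} (hN : Module.finrank F A < N) (u x w : Fin N → A) :
    capelli u x w = 0 := by
  let f : MultilinearMap F (fun _ : Fin N => A) A :=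
    (MultilinearMap.mkPiAlgebraFin F N A).compLinearMap
      (fun t => (LinearMap.mulRight F (w t)).comp (LinearMap.mulLeft F (u t)))
  have hf : capelli u x w = MultilinearMap.alternatization f x := by
    simp [capelli, MultilinearMap.alternatization_apply, f]
  rw [hf]
  apply AlternatingMap.map_linearDependent
  intro h
  have := h.fintype_card_le_finrank
  simp at this
  omega

lemma exists_capelli_matrix_ne_zero {F : Type*} [Field F] {d N : ℕ} (hN : N ≤ d * d) (hd : 0 < d) :
    ∃ u x w : Fin N → Matrix (Fin d) (Fin d) F, capelli u x w ≠ 0 := by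
  classical
  obtain ⟨e⟩ : Nonempty (Fin N ↪ Fin d × Fin d) :=
    Function.Embedding.nonempty_of_card_le (by simpa using hN)
  let o : Fin d := ⟨0, hd⟩
  refine ⟨fun t => Matrix.single o (e t).1 1, fun s => Matrix.single (e s).1 (e s).2 1,
    fun t => Matrix.single (e t).2 o 1, ?_⟩
  have key : ∀ s t : Fin N, Matrix.single o (e t).1 (1 : F) * Matrix.single (e s).1 (e s).2 1 *
      Matrix.single (e t).2 o 1 = if s = t then Matrix.single o o 1 else 0 := by
    intro s t
    split_ifs with h
    · subst h; simp
    · have : e s ≠ e t := fun h' => h (e.injective h')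
      by_cases h1 : (e t).1 = (e s).1
      · have h2 : (e s).2 ≠ (e t).2 := fun h2 => this (Prod.ext h1.symm h2)
        rw [mul_assoc, Matrix.single_mul_single_of_ne _ _ _ _ h2, mul_zero]
      · rw [Matrix.single_mul_single_of_ne _ _ _ _ h1, zero_mul]
  intro h
  rw [capelli, Finset.sum_eq_single 1] at h
  · simp only [Equiv.Perm.sign_one, Equiv.Perm.one_apply, key, if_true, one_smul,
      List.ofFn_const, List.prod_replicate] at h
    have hid : IsIdempotentElem (Matrix.single o o (1 : F)) := by simp [IsIdempotentElem]
    rcases Nat.eq_zero_or_pos N with h0 | h0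
    · rw [h0, pow_zero] at h
      simpa using congrFun (congrFun h o) o
    · rw [hid.pow_eq h0.ne'] at h
      simpa using congrFun (congrFun h o) o
  · intro σ _ hσ
    obtain ⟨t, ht⟩ : ∃ t, σ t ≠ t := by
      by_contra! hh
      exact hσ (Equiv.ext hh)
    have : (0 : Matrix (Fin d) (Fin d) F) ∈ List.ofFn fun t => (Matrix.single o (e t).1 (1 : F) *
        Matrix.single (e (σ t)).1 (e (σ t)).2 1 * Matrix.single (e t).2 o 1) := by
      rw [List.mem_ofFn]
      exact ⟨t, by rw [key, if_neg ht]⟩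
    rw [List.prod_eq_zero this, smul_zero]
  · simp

lemma exists_capelli_end_ne_zero {F M : Type*} [Field F] [AddCommGroup M] [Module F M]
    [Module.Finite F M] {N : ℕ} (hN : N ≤ Module.finrank F M * Module.finrank F M)
    (hd : 0 < Module.finrank F M) :
    ∃ u x w : Fin N → Module.End F M, capelli u x w ≠ 0 := by
  obtain ⟨u, x, w, h⟩ := exists_capelli_matrix_ne_zero (F := F) hN hd
  let e := (algEquivMatrix (Module.finBasis F M)).symm.toRingEquiv
  refine ⟨e ∘ u, e ∘ x, e ∘ w, fun h0 => h ?_⟩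
  apply e.injective
  rw [map_zero, ← h0]
  exact map_capelli e.toRingHom u x w

/-- In characteristic `p`, a matrix with `B ^ p = B` has trace in the prime field. -/
lemma Matrix.trace_pow_char_eq_self {E : Type*} [Field E] {p : ℕ} [Fact p.Prime] [CharP E p]
    {d : Type*} [Fintype d] [DecidableEq d] (B : Matrix d d E) (hB : B ^ p = B) :
    B.trace ^ p = B.trace := by
  let K := AlgebraicClosure E
  let f := algebraMap E K
  have : CharP K p := charP_of_injective_algebraMap f.injective p
  have : ExpChar K p := ExpChar.prime Fact.out
  have hC : (f.mapMatrix B) ^ p = f.mapMatrix B := by rw [← map_pow, hB]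
  have hroot : ∀ μ ∈ (f.mapMatrix B).charpoly.roots, μ ^ p = μ := by
    intro μ hμ
    have h1 : Module.End.HasEigenvalue (Matrix.toLin' (f.mapMatrix B)) μ := by
      rw [Module.End.hasEigenvalue_iff_isRoot_charpoly, Matrix.charpoly_toLin']
      exact (Polynomial.mem_roots'.1 hμ).2
    obtain ⟨v, hv⟩ := h1.exists_hasEigenvector
    have h2 := hv.pow_apply p
    rw [← Matrix.toLin'_pow, hC, hv.apply_eq_smul] at h2
    exact (smul_left_injective _ hv.2 h2).symm
  have htr : (f.mapMatrix B).trace ^ p = (f.mapMatrix B).trace := by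
    rw [Matrix.trace_eq_sum_roots_charpoly]
    change frobenius K p _ = _
    rw [map_multiset_sum]
    congr 1
    conv_rhs => rw [← Multiset.map_id (f.mapMatrix B).charpoly.roots]
    exact Multiset.map_congr rfl hroot
  apply f.injective
  rw [map_pow]
  simpa [Matrix.trace, map_sum] using htr

lemma LinearMap.trace_pow_char_eq_self {E M : Type*} [Field E] {p : ℕ} [Fact p.Prime] [CharP E p]
    [AddCommGroup M] [Module E M] [Module.Finite E M] (T : Module.End E M) (hT : T ^ p = T) :
    LinearMap.trace E M T ^ p = LinearMap.trace E M T := by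
  let b := Module.finBasis E M
  rw [LinearMap.trace_eq_matrix_trace E b]
  apply Matrix.trace_pow_char_eq_self
  conv_rhs => rw [← hT]
  exact (map_pow (LinearMap.toMatrixAlgEquiv b) T p).symm

/-- If every endomorphism over a field `E` of characteristic `p` comes from `𝔽_p[H]`, with
`p ≡ 1` modulo the order of `H`, then `E` is the prime field. -/
lemma exists_intCast_eq_of_groupAlgebra_surjective {H E M : Type*} [Group H] [Finite H] {p : ℕ}
    [Fact p.Prime] (hp : p ≡ 1 [MOD Nat.card H]) [Field E] [CharP E p] [AddCommGroup M]
    [Module E M] [Module.Finite E M] [Nontrivial M] [Module (MonoidAlgebra (ZMod p) H) M]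
    [SMulCommClass (MonoidAlgebra (ZMod p) H) E M]
    (hsurj : Function.Surjective (Module.toModuleEnd E (S := MonoidAlgebra (ZMod p) H) M)) (e : E) :
    ∃ n : ℤ, n = e := by
  rw [← mem_bot_iff_intCast p, Subfield.mem_bot_iff_pow_eq_self E p]
  have : ExpChar E p := ExpChar.prime Fact.out
  have hg : ∀ g : H, g ^ p = g := by
    intro g
    have h1 : p ≡ 1 [MOD orderOf g] := hp.of_dvd (orderOf_dvd_natCard g)
    have := pow_eq_pow_iff_modEq.2 h1
    simpa using this
  have key : ∀ a : MonoidAlgebra (ZMod p) H,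
      LinearMap.trace E M (Module.toModuleEnd E M a) ^ p =
        LinearMap.trace E M (Module.toModuleEnd E M a) := by
    intro a
    induction a using MonoidAlgebra.induction_linear with
    | zero => rw [map_zero, map_zero, zero_pow (Fact.out : p.Prime).ne_zero]
    | add x y hx hy => rw [map_add, map_add, add_pow_expChar, hx, hy]
    | single g c =>
      have h1 : MonoidAlgebra.single g c = c.val • MonoidAlgebra.single g (1 : ZMod p) := by
        rw [MonoidAlgebra.smul_single]; simp
      have h2 := LinearMap.trace_pow_char_eq_self
        (Module.toModuleEnd E M (MonoidAlgebra.single g (1 : ZMod p)))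
        (by rw [← map_pow, MonoidAlgebra.single_pow, hg, one_pow])
      rw [h1, map_nsmul, map_nsmul, nsmul_eq_mul, mul_pow, h2]
      congr 1
      exact map_natCast (frobenius E p) _
  obtain ⟨x, hx⟩ := exists_ne (0 : M)
  obtain ⟨f, hf⟩ : ∃ f : Module.Dual E M, f x = 1 :=
    Module.Projective.exists_dual_eq_one E hx
  obtain ⟨a, ha⟩ := hsurj (dualTensorHom E M M (f ⊗ₜ[E] (e • x)))
  have := key a
  rw [ha] at this
  simpa [LinearMap.trace_eq_contract_apply, hf] using this

lemma MonoidAlgebra.exists_zsmul_eq_of_simple {H M : Type*} [Group H] [Finite H] {p : ℕ}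
    [Fact p.Prime] (hp : p ≡ 1 [MOD Nat.card H]) [AddCommGroup M] [Module (ZMod p) M]
    [Module (MonoidAlgebra (ZMod p) H) M]
    [IsScalarTower (ZMod p) (MonoidAlgebra (ZMod p) H) M] [Finite M]
    [IsSimpleModule (MonoidAlgebra (ZMod p) H) M]
    (e : Module.End (MonoidAlgebra (ZMod p) H) M) : ∃ n : ℤ, ∀ x, e x = n • x := by
  classical
  have : Finite (Module.End (MonoidAlgebra (ZMod p) H) M) :=
    Finite.of_injective (fun f => (f : M → M)) DFunLike.coe_injective
  have : Nontrivial M := IsSimpleModule.nontrivial (MonoidAlgebra (ZMod p) H) M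
  have : CharP (Module.End (MonoidAlgebra (ZMod p) H) M) p := by
    have : Algebra (ZMod p) (Module.End (MonoidAlgebra (ZMod p) H) M) := inferInstance
    exact charP_of_injective_algebraMap (algebraMap (ZMod p) _).injective p
  obtain ⟨n, hn⟩ := exists_intCast_eq_of_groupAlgebra_surjective
    (E := Module.End (MonoidAlgebra (ZMod p) H) M) hp
    Module.Finite.toModuleEnd_moduleEnd_surjective e
  exact ⟨n, fun x => by rw [← hn]; exact Module.End.intCast_apply n x⟩

lemma MonoidAlgebra.toModuleEnd_surjective_of_simple {H M : Type*} [Group H] [Finite H] {p : ℕ}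
    [Fact p.Prime] (hp : p ≡ 1 [MOD Nat.card H]) [AddCommGroup M] [Module (ZMod p) M]
    [Module (MonoidAlgebra (ZMod p) H) M]
    [IsScalarTower (ZMod p) (MonoidAlgebra (ZMod p) H) M] [Finite M]
    [IsSimpleModule (MonoidAlgebra (ZMod p) H) M] :
    Function.Surjective (Module.toModuleEnd (ZMod p) (S := MonoidAlgebra (ZMod p) H) M) := by
  intro f
  let f' : Module.End (Module.End (MonoidAlgebra (ZMod p) H) M) M :=
    { f with
      map_smul' := fun e x => by
        obtain ⟨n, hn⟩ := MonoidAlgebra.exists_zsmul_eq_of_simple hp e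
        simp [hn] }
  obtain ⟨a, ha⟩ := Module.Finite.toModuleEnd_moduleEnd_surjective f'
  exact ⟨a, LinearMap.ext fun x => LinearMap.congr_fun ha x⟩

/-- A faithful enough identity bounds the dimension of simple modules in characteristic `p`. -/
lemma MonoidAlgebra.finrank_le_of_capelli {H M : Type*} [Group H] [Finite H] {p k : ℕ}
    [Fact p.Prime] (hp : p ≡ 1 [MOD Nat.card H]) [AddCommGroup M] [Module (ZMod p) M]
    [Module (MonoidAlgebra (ZMod p) H) M]
    [IsScalarTower (ZMod p) (MonoidAlgebra (ZMod p) H) M] [Finite M]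
    [IsSimpleModule (MonoidAlgebra (ZMod p) H) M]
    (hc : ∀ (u x w : Fin (k * k + 1) → MonoidAlgebra (ZMod p) H) (y : M),
      capelli u x w • y = 0) :
    Module.finrank (ZMod p) M ≤ k := by
  by_contra! hlt
  obtain ⟨u, x, w, h⟩ := exists_capelli_end_ne_zero (F := ZMod p) (M := M) (N := k * k + 1)
    (by nlinarith) (by omega)
  have hs := MonoidAlgebra.toModuleEnd_surjective_of_simple (M := M) hp
  obtain ⟨u', rfl⟩ := hs.comp_left u
  obtain ⟨x', rfl⟩ := hs.comp_left x
  obtain ⟨w', rfl⟩ := hs.comp_left w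
  apply h
  rw [← map_capelli]
  exact LinearMap.ext fun y => hc u' x' w' y

/-- The representation over a field `F` obtained from an integral one by extension of scalars. -/
noncomputable def integralRep {H : Type*} [Group H] {m : ℕ}
    (φ : H →* Matrix.GeneralLinearGroup (Fin m) ℤ) (F : Type*) [Field F] :
    Representation F H (Fin m → F) :=
  (Matrix.toLinAlgEquiv' : Matrix (Fin m) (Fin m) F ≃ₐ[F] _).toAlgHom.toMonoidHom.comp
    ((Int.castRingHom F).mapMatrix.toMonoidHom.comp ((Units.coeHom _).comp φ))

lemma integralRep_apply {H : Type*} [Group H] {m : ℕ}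
    (φ : H →* Matrix.GeneralLinearGroup (Fin m) ℤ) (F : Type*) [Field F] (h : H) (y : Fin m → F) :
    integralRep φ F h y =
      ((φ h : Matrix (Fin m) (Fin m) ℤ).map (Int.cast : ℤ → F)).mulVec y := rfl

lemma integralRep_asAlgebraHom_map {H : Type*} [Group H] {m : ℕ}
    (φ : H →* Matrix.GeneralLinearGroup (Fin m) ℤ) (F : Type*) [Field F] (z : MonoidAlgebra ℤ H) :
    (integralRep φ F).asAlgebraHom (MonoidAlgebra.mapRingHom H (Int.castRingHom F) z) =
      Matrix.toLinAlgEquiv' ((MonoidAlgebra.lift ℤ _ H ((Units.coeHom _).comp φ) z).map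
        (Int.cast : ℤ → F)) := by
  induction z using MonoidAlgebra.induction_linear with
  | zero => simp
  | add x y hx hy =>
    rw [map_add, map_add, hx, hy, map_add, Matrix.map_add _ Int.cast_add, map_add]
  | single h n =>
    ext y i
    rw [MonoidAlgebra.mapRingHom_single, Representation.asAlgebraHom_single,
      MonoidAlgebra.lift_single]
    simp [integralRep, Matrix.mulVec, dotProduct, Pi.single_apply, -zsmul_eq_mul]

lemma capelli_smul_eq_zero_of_finrank_le {F A V : Type*} [Field F] [Ring A] [Algebra F A]
    [AddCommGroup V] [Module F V] [Module A V] [IsScalarTower F A V] [Module.Finite F V]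
    [IsSemisimpleModule A V] {k : ℕ}
    (hk : ∀ W : Submodule A V, IsSimpleModule A W → Module.finrank F W ≤ k)
    (u x w : Fin (k * k + 1) → A) (y : V) : capelli u x w • y = 0 := by
  have hsimple : ∀ W : Submodule A V, IsSimpleModule A W → ∀ y ∈ W, capelli u x w • y = 0 := by
    intro W hW y hy
    have hfin := hk W hW
    have : Module.Finite F W := inferInstanceAs (Module.Finite F (W.restrictScalars F))
    have h0 := capelli_eq_zero_of_finrank_lt (F := F) (A := Module.End F W) (N := k * k + 1)
      (by rw [Module.finrank_linearMap]; nlinarith)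
      (Module.toModuleEnd F W ∘ u) (Module.toModuleEnd F W ∘ x) (Module.toModuleEnd F W ∘ w)
    rw [← map_capelli] at h0
    exact congrArg Subtype.val (LinearMap.congr_fun h0 ⟨y, hy⟩)
  have hy : y ∈ sSup {W : Submodule A V | IsSimpleModule A W} := by
    rw [IsSemisimpleModule.sSup_simples_eq_top]
    trivial
  rw [sSup_eq_iSup'] at hy
  refine Submodule.iSup_induction _ (motive := fun y => capelli u x w • y = 0) hy
    (fun W y hy => hsimple W.1 W.2 y hy) (smul_zero _) (fun a b ha hb => ?_)
  rw [smul_add, ha, hb, add_zero]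

lemma isIrredC_map_asModuleEquiv {H : Type*} [Group H] {m : ℕ}
    (φ : H →* Matrix.GeneralLinearGroup (Fin m) ℤ)
    (W : Submodule (MonoidAlgebra ℂ H) (integralRep φ ℂ).asModule)
    (hW : IsSimpleModule (MonoidAlgebra ℂ H) W) :
    IsIrredC (fun h => (φ h : Matrix (Fin m) (Fin m) ℤ))
      ((W.restrictScalars ℂ).map (integralRep φ ℂ).asModuleEquiv.toLinearMap) := by
  rw [isSimpleModule_iff_isAtom] at hW
  refine ⟨?_, ?_, ?_⟩
  · rw [Ne, Submodule.map_eq_bot_iff]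
    simpa using hW.1
  · rintro h _ ⟨y, hy, rfl⟩
    refine ⟨MonoidAlgebra.of ℂ H h • y, W.smul_mem _ hy, ?_⟩
    simp only [LinearEquiv.coe_coe]
    rw [Representation.asModuleEquiv_map_smul, Representation.asAlgebraHom_of]
    rfl
  · intro U hU hU0 hUinv
    let U' : Submodule (MonoidAlgebra ℂ H) (integralRep φ ℂ).asModule :=
      { (U.comap (integralRep φ ℂ).asModuleEquiv.toLinearMap) with
        smul_mem' := fun a y hy => by
          change (integralRep φ ℂ).asModuleEquiv (a • y) ∈ U
          rw [Representation.asModuleEquiv_map_smul]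
          replace hy : (integralRep φ ℂ).asModuleEquiv y ∈ U := hy
          induction a using MonoidAlgebra.induction_linear with
          | zero => simp
          | add a b ha hb => rw [map_add]; exact U.add_mem ha hb
          | single h c =>
            rw [Representation.asAlgebraHom_single]
            exact U.smul_mem _ (hUinv h _ hy) }
    have hle : U' ≤ W := by
      intro y hy
      obtain ⟨z, hz, hzy⟩ := hU hy
      rwa [← (integralRep φ ℂ).asModuleEquiv.injective hzy]
    rcases hW.le_iff.1 hle with h | h
    · refine absurd ?_ hU0
      rw [eq_bot_iff]
      intro y hy
      have : (integralRep φ ℂ).asModuleEquiv.symm y ∈ U' := by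
        change (integralRep φ ℂ).asModuleEquiv ((integralRep φ ℂ).asModuleEquiv.symm y) ∈ U
        simpa using hy
      rw [h] at this
      simpa using this
    · refine le_antisymm hU ?_
      rintro _ ⟨y, hy, rfl⟩
      have hy' : y ∈ W := hy
      rw [← h] at hy'
      exact hy'

/-- If all irreducible subrepresentations over `ℂ` have dimension at most `k`, then the group
algebra satisfies the Capelli identity of order `k ^ 2 + 1` on `ℂ ^ m`. -/
lemma capelli_smul_eq_zero_of_isIrredC {H : Type*} [Group H] [Finite H] {m : ℕ}
    (φ : H →* Matrix.GeneralLinearGroup (Fin m) ℤ) (k : ℕ)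
    (hk : ∀ W : Submodule ℂ (Fin m → ℂ),
      IsIrredC (fun h => (φ h : Matrix (Fin m) (Fin m) ℤ)) W → Module.finrank ℂ W ≤ k)
    (u x w : Fin (k * k + 1) → MonoidAlgebra ℂ H) (y : (integralRep φ ℂ).asModule) :
    capelli u x w • y = 0 := by
  have : NeZero (Nat.card H : ℂ) := ⟨by exact_mod_cast Nat.card_pos.ne'⟩
  refine capelli_smul_eq_zero_of_finrank_le (F := ℂ) (fun W hW => ?_) u x w y
  refine le_of_eq_of_le ?_ (hk _ (isIrredC_map_asModuleEquiv φ W hW))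
  exact ((integralRep φ ℂ).asModuleEquiv.submoduleMap (W.restrictScalars ℂ)).finrank_eq

lemma capelli_map_int_smul_eq_zero {H : Type*} [Group H] [Finite H] {m : ℕ}
    (φ : H →* Matrix.GeneralLinearGroup (Fin m) ℤ) (k : ℕ)
    (hk : ∀ W : Submodule ℂ (Fin m → ℂ),
      IsIrredC (fun h => (φ h : Matrix (Fin m) (Fin m) ℤ)) W → Module.finrank ℂ W ≤ k)
    {F : Type*} [Field F] (hF : Function.Surjective (Int.cast : ℤ → F))
    (u x w : Fin (k * k + 1) → MonoidAlgebra F H) (y : (integralRep φ F).asModule) :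
    capelli u x w • y = 0 := by
  have hs : Function.Surjective (MonoidAlgebra.mapRingHom H (Int.castRingHom F)) :=
    MonoidAlgebra.map_surjective _ hF
  obtain ⟨u, rfl⟩ := hs.comp_left u
  obtain ⟨x, rfl⟩ := hs.comp_left x
  obtain ⟨w, rfl⟩ := hs.comp_left w
  have hZ : MonoidAlgebra.lift ℤ _ H ((Units.coeHom _).comp φ) (capelli u x w) = 0 := by
    have h1 := integralRep_asAlgebraHom_map φ ℂ (capelli u x w)
    rw [map_capelli] at h1
    have h2 : (integralRep φ ℂ).asAlgebraHom (capelli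
        (MonoidAlgebra.mapRingHom H (Int.castRingHom ℂ) ∘ u)
        (MonoidAlgebra.mapRingHom H (Int.castRingHom ℂ) ∘ x)
        (MonoidAlgebra.mapRingHom H (Int.castRingHom ℂ) ∘ w)) = 0 :=
      LinearMap.ext fun y => capelli_smul_eq_zero_of_isIrredC φ k hk _ _ _ y
    rw [h2] at h1
    have h3 := (map_eq_zero_iff _ (AlgEquiv.injective _)).1 h1.symm
    ext i j
    simpa using congrFun (congrFun h3 i) j
  apply (integralRep φ F).asModuleEquiv.injective
  rw [Representation.asModuleEquiv_map_smul, ← map_capelli, integralRep_asAlgebraHom_map, hZ]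
  simp

lemma exists_invSet_index_le {H : Type*} [Group H] [Finite H] {m : ℕ}
    (φ : H →* Matrix.GeneralLinearGroup (Fin m) ℤ) (k : ℕ)
    (hk : ∀ W : Submodule ℂ (Fin m → ℂ),
      IsIrredC (fun h => (φ h : Matrix (Fin m) (Fin m) ℤ)) W → Module.finrank ℂ W ≤ k)
    {p : ℕ} (hprime : p.Prime) (hp : p ≡ 1 [MOD Nat.card H]) (v : Fin m → ℤ) (i : Fin m)
    (hv : ¬ (p : ℤ) ∣ v i) :
    ∃ N ∈ InvSet φ, v ∉ N ∧ N.index ≤ p ^ k := by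
  have : Fact p.Prime := ⟨hprime⟩
  let ρ := integralRep φ (ZMod p)
  let A := MonoidAlgebra (ZMod p) H
  have : NeZero (Nat.card H : ZMod p) := ⟨by
    rw [Ne, ZMod.natCast_eq_zero_iff]
    intro h
    have h1 : p ≡ 1 [MOD p] := hp.of_dvd h
    have h2 := (Nat.modEq_zero_iff_dvd.2 (dvd_refl p)).symm.trans h1
    have := (Nat.modEq_iff_dvd' (Nat.zero_le 1)).1 h2
    exact hprime.one_lt.ne' (Nat.dvd_one.1 this)⟩
  let red : (Fin m → ℤ) →+ ρ.asModule :=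
    { toFun := fun y => ρ.asModuleEquiv.symm (fun j => (y j : ZMod p))
      map_zero' := by
        rw [← map_zero ρ.asModuleEquiv.symm]; congr 1; ext; simp
      map_add' := fun y z => by
        rw [← map_add ρ.asModuleEquiv.symm]; congr 1; ext; simp }
  have hred : Function.Surjective red := by
    intro y
    choose z hz using fun j => ZMod.intCast_surjective (ρ.asModuleEquiv y j)
    refine ⟨z, ρ.asModuleEquiv.injective ?_⟩
    simp [red, hz]
  have hact : ∀ h y, red (intAct (φ h : Matrix (Fin m) (Fin m) ℤ) y) =
      MonoidAlgebra.of (ZMod p) H h • red y := by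
    intro h y
    apply ρ.asModuleEquiv.injective
    rw [Representation.asModuleEquiv_map_smul, Representation.asAlgebraHom_of, integralRep_apply]
    ext j
    simp [red, intAct, Matrix.mulVec, dotProduct]
  have hv0 : red v ≠ 0 := by
    intro h
    have h1 : (fun j => (v j : ZMod p)) = 0 := by
      rw [← map_eq_zero_iff _ ρ.asModuleEquiv.symm.injective]
      exact h
    exact hv ((ZMod.intCast_zmod_eq_zero_iff_dvd _ p).1 (congrFun h1 i))
  obtain ⟨N₀, hN₀, hvN₀⟩ : ∃ N₀ : Submodule A ρ.asModule, IsCoatom N₀ ∧ red v ∉ N₀ := by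
    by_contra! hh
    apply hv0
    have := IsSemisimpleModule.jacobson_eq_bot A ρ.asModule
    rw [← Submodule.mem_bot A, ← this]
    simpa [Module.jacobson] using hh
  have hsimple : IsSimpleModule A (ρ.asModule ⧸ N₀) := isSimpleModule_iff_isCoatom.2 hN₀
  have hfinV : Finite ρ.asModule := inferInstanceAs (Finite (Fin m → ZMod p))
  have hfin : Finite (ρ.asModule ⧸ N₀) := Finite.of_surjective _ N₀.mkQ_surjective
  have hrank : Module.finrank (ZMod p) (ρ.asModule ⧸ N₀) ≤ k := by
    refine MonoidAlgebra.finrank_le_of_capelli hp fun u x w y => ?_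
    obtain ⟨y, rfl⟩ := N₀.mkQ_surjective y
    rw [← map_smul, capelli_map_int_smul_eq_zero φ k hk ZMod.intCast_surjective, map_zero]
  let q : (Fin m → ℤ) →+ (ρ.asModule ⧸ N₀) := N₀.mkQ.toAddMonoidHom.comp red
  have hq : Function.Surjective q := N₀.mkQ_surjective.comp hred
  have hmem : ∀ y, y ∈ q.ker ↔ red y ∈ N₀ := fun y => by
    simp [q, AddMonoidHom.mem_ker]
  have hindex : q.ker.index = p ^ Module.finrank (ZMod p) (ρ.asModule ⧸ N₀) := by
    rw [AddSubgroup.index_ker, AddMonoidHom.range_eq_top.2 hq, AddSubgroup.card_top,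
      Module.natCard_eq_pow_finrank (K := ZMod p), Nat.card_zmod]
  have hle : ∀ h, q.ker.map (intAct (φ h : Matrix (Fin m) (Fin m) ℤ)) ≤ q.ker := by
    rintro h _ ⟨y, hy, rfl⟩
    rw [hmem, hact]
    exact N₀.smul_mem _ ((hmem y).1 hy)
  refine ⟨q.ker, ⟨⟨?_⟩, fun h => le_antisymm (hle h) ?_⟩, ?_, ?_⟩
  · rw [hindex]
    exact pow_ne_zero _ hprime.ne_zero
  · intro y hy
    refine ⟨intAct (φ h⁻¹ : Matrix (Fin m) (Fin m) ℤ) y, hle h⁻¹ ⟨y, hy, rfl⟩, ?_⟩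
    simp [intAct, Matrix.mulVec_mulVec]
  · rwa [hmem]
  · rw [hindex]
    exact Nat.pow_le_pow_right hprime.pos hrank

lemma norm_sum_range_smul_le_of_antitone {f : ℕ → ℝ} (hf : Antitone f) (hf0 : ∀ n, 0 ≤ f n)
    {a : ℕ → ℂ} {B : ℝ} (hB : ∀ n, ‖∑ i ∈ Finset.range n, a i‖ ≤ B) (n : ℕ) :
    ‖∑ i ∈ Finset.range n, f i • a i‖ ≤ B * f 0 := by
  have hB0 : 0 ≤ B := (norm_nonneg _).trans (hB 0)
  rw [Finset.sum_range_by_parts]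
  calc _ ≤ f (n - 1) * B + ∑ i ∈ Finset.range (n - 1), (f i - f (i + 1)) * B := by
        refine (norm_sub_le _ _).trans (add_le_add ?_ ((norm_sum_le _ _).trans
          (Finset.sum_le_sum fun i _ => ?_)))
        · rw [norm_smul, Real.norm_of_nonneg (hf0 _)]
          exact mul_le_mul_of_nonneg_left (hB n) (hf0 _)
        · rw [norm_smul, Real.norm_eq_abs, abs_sub_comm,
            abs_of_nonneg (sub_nonneg.2 (hf (Nat.le_succ i)))]
          exact mul_le_mul_of_nonneg_left (hB _) (sub_nonneg.2 (hf (Nat.le_succ i)))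
    _ = B * f 0 := by
        rw [← Finset.sum_mul, Finset.sum_range_sub']
        ring

lemma DirichletCharacter.norm_sum_range_add_le {q : ℕ} [NeZero q] {χ : DirichletCharacter ℂ q}
    (hχ : χ ≠ 1) (M n : ℕ) : ‖∑ i ∈ Finset.range n, χ ((M + i : ℕ) : ZMod q)‖ ≤ q := by
  set F : ℕ → ℂ := fun n => ∑ i ∈ Finset.range n, χ ((M + i : ℕ) : ZMod q) with hF
  have hper : Function.Periodic F q := by
    intro n
    have hsum : ∑ i ∈ Finset.range q, χ ((M + (n + i) : ℕ) : ZMod q) = 0 := by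
      rw [← MulChar.sum_eq_zero_of_ne_one hχ,
        ← Equiv.sum_comp (Equiv.addLeft ((M + n : ℕ) : ZMod q)) (fun a => χ a)]
      refine Finset.sum_bij (fun i _ => (i : ZMod q)) (fun _ _ => Finset.mem_univ _) ?_ ?_ ?_
      · intro i hi j hj h
        rw [ZMod.natCast_eq_natCast_iff'] at h
        rwa [Nat.mod_eq_of_lt (Finset.mem_range.1 hi), Nat.mod_eq_of_lt (Finset.mem_range.1 hj)]
          at h
      · intro b _
        exact ⟨b.val, Finset.mem_range.2 (ZMod.val_lt b), ZMod.natCast_rightInverse b⟩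
      · intro i _
        simp
    simp only [hF, Finset.sum_range_add, hsum, add_zero]
  rw [show (∑ i ∈ Finset.range n, χ ((M + i : ℕ) : ZMod q)) = F n from rfl, ← hper.map_mod_nat n]
  calc ‖F (n % q)‖ ≤ ∑ i ∈ Finset.range (n % q), ‖χ ((M + i : ℕ) : ZMod q)‖ := norm_sum_le _ _
    _ ≤ ∑ i ∈ Finset.range (n % q), 1 := Finset.sum_le_sum fun i _ => χ.norm_le_one _
    _ = ((n % q : ℕ) : ℝ) := by simp
    _ ≤ q := by exact_mod_cast (Nat.mod_lt _ (NeZero.pos q)).le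

lemma DirichletCharacter.norm_sum_Ioc_mul_le {q : ℕ} [NeZero q] {χ : DirichletCharacter ℂ q}
    (hχ : χ ≠ 1) {f : ℕ → ℝ} {M : ℕ} (hf : AntitoneOn f (Set.Ioi M)) (hf0 : ∀ n, 0 ≤ f n) (N : ℕ) :
    ‖∑ n ∈ Finset.Ioc M N, (f n : ℂ) * χ n‖ ≤ q * f (M + 1) := by
  rcases le_total N M with h | h
  · rw [Finset.Ioc_eq_empty_of_le h, Finset.sum_empty, norm_zero]
    exact mul_nonneg (Nat.cast_nonneg _) (hf0 _)
  · have := norm_sum_range_smul_le_of_antitone (f := fun i => f (M + 1 + i))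
      (fun a b hab => hf (Set.mem_Ioi.2 (by lia)) (Set.mem_Ioi.2 (by lia)) (by lia)) (fun _ => hf0 _)
      (χ.norm_sum_range_add_le hχ (M + 1)) (N - M)
    have e : Finset.Ioc M N = Finset.Ico (M + 1) (N + 1) := by
      ext
      simp only [Finset.mem_Ioc, Finset.mem_Ico]
      lia
    rw [e, Finset.sum_Ico_eq_sum_range]
    simpa [show N + 1 - (M + 1) = N - M by lia] using this

lemma DirichletCharacter.norm_LFunction_one_sub_sum_le {q : ℕ} [NeZero q]
    {χ : DirichletCharacter ℂ q} (hχ : χ ≠ 1) (M : ℕ) :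
    ‖LFunction χ 1 - ∑ n ∈ Finset.Ioc 0 M, χ n / n‖ ≤ q / (M + 1) := by
  have key : ∀ s : ℝ, 1 < s →
      ‖LFunction χ s - ∑ n ∈ Finset.Ioc 0 M, (((n : ℝ) ^ (-s) : ℝ) : ℂ) * χ n‖ ≤ q / (M + 1) := by
    intro s hs
    have hsum := (LSeriesSummable_of_one_lt_re χ (s := s) (by simpa using hs)).LSeriesHasSum
    rw [← LFunction_eq_LSeries χ (s := s) (by simpa using hs)] at hsum
    have hterm : ∀ n : ℕ, LSeries.term (fun n => χ n) s n = (((n : ℝ) ^ (-s) : ℝ) : ℂ) * χ n := by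
      intro n
      rcases eq_or_ne n 0 with rfl | hn
      · rw [LSeries.term_zero, Nat.cast_zero, Real.zero_rpow (by linarith)]
        simp
      · rw [LSeries.term_of_ne_zero hn, Real.rpow_neg (Nat.cast_nonneg n)]
        push_cast
        rw [Complex.ofReal_cpow (Nat.cast_nonneg n)]
        push_cast
        ring
    have hlim := (hsum.tendsto_sum_nat.comp (Filter.tendsto_add_atTop_nat 1)).sub_const
      (∑ n ∈ Finset.Ioc 0 M, (((n : ℝ) ^ (-s) : ℝ) : ℂ) * χ n)
    refine le_of_tendsto hlim.norm (Filter.eventually_atTop.2 ⟨M, fun N hN => ?_⟩)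
    have hsplit : ∑ n ∈ Finset.range (N + 1), LSeries.term (fun n => χ n) s n
        = ∑ n ∈ Finset.Ioc 0 M, (((n : ℝ) ^ (-s) : ℝ) : ℂ) * χ n
          + ∑ n ∈ Finset.Ioc M N, (((n : ℝ) ^ (-s) : ℝ) : ℂ) * χ n := by
      rw [Finset.sum_Ioc_consecutive _ (Nat.zero_le _) hN, Finset.range_eq_Ico,
        Finset.sum_eq_sum_Ico_succ_bot (Nat.succ_pos N), LSeries.term_zero, zero_add]
      refine Finset.sum_congr (by ext; simp; lia) fun n _ => hterm n
    simp only [Function.comp, hsplit, add_sub_cancel_left]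
    refine (norm_sum_Ioc_mul_le hχ (f := fun n : ℕ => (n : ℝ) ^ (-s)) ?_
      (fun n => by positivity) N).trans ?_
    · intro a ha b _ hab
      exact Real.rpow_le_rpow_of_nonpos (by simp at ha; exact_mod_cast (by lia : 0 < a))
        (by exact_mod_cast hab) (by linarith)
    · rw [div_eq_mul_inv]
      refine mul_le_mul_of_nonneg_left ?_ (Nat.cast_nonneg _)
      rw [← Real.rpow_neg_one]
      push_cast
      exact Real.rpow_le_rpow_of_exponent_le (by linarith [(Nat.cast_nonneg M : (0:ℝ) ≤ M)])
        (by linarith)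
  have hcont : ContinuousAt (fun s : ℝ =>
      LFunction χ s - ∑ n ∈ Finset.Ioc 0 M, (((n : ℝ) ^ (-s) : ℝ) : ℂ) * χ n) 1 := by
    refine ContinuousAt.sub ((differentiable_LFunction hχ).continuous.comp
      Complex.continuous_ofReal).continuousAt (tendsto_finsetSum _ fun n hn => ?_)
    refine Filter.Tendsto.mul_const _ (Complex.continuous_ofReal.continuousAt.comp ?_)
    refine ContinuousAt.rpow continuousAt_const continuousAt_neg (Or.inl ?_)
    have := (Finset.mem_Ioc.1 hn).1
    positivity
  have := le_of_tendsto (hcont.mono_left nhdsWithin_le_nhds : 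
      Filter.Tendsto _ (nhdsWithin (1 : ℝ) (Set.Ioi 1)) _).norm
    (Filter.eventually_of_mem self_mem_nhdsWithin fun s hs => key s hs)
  simp only [Complex.ofReal_one, Real.rpow_neg_one, Complex.ofReal_inv,
    Complex.ofReal_natCast] at this
  simpa only [div_eq_inv_mul] using this

lemma DirichletCharacter.exists_norm_sum_log_div_le {q : ℕ} [NeZero q]
    {χ : DirichletCharacter ℂ q} (hχ : χ ≠ 1) :
    ∃ C : ℝ, ∀ N : ℕ, ‖∑ n ∈ Finset.Ioc 0 N, ((Real.log n / n : ℝ) : ℂ) * χ n‖ ≤ C := by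
  have hpos : ∀ n : ℕ, 0 ≤ Real.log n / n := fun n =>
    div_nonneg (Real.log_natCast_nonneg n) (Nat.cast_nonneg n)
  have h2 := fun N => norm_sum_Ioc_mul_le hχ (f := fun n : ℕ => Real.log n / n) (M := 2) (by
    intro a ha b hb hab
    have h3 : ∀ c : ℕ, c ∈ Set.Ioi 2 → (c : ℝ) ∈ {x | Real.exp 1 ≤ x} := by
      intro c hc
      have : (3 : ℝ) ≤ c := by exact_mod_cast hc
      exact (Real.exp_one_lt_d9.le.trans (by norm_num)).trans this
    exact Real.log_div_self_antitoneOn (h3 a ha) (h3 b hb) (by exact_mod_cast hab)) hpos N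
  refine ⟨∑ n ∈ Finset.Ioc (0 : ℕ) 2, ‖((Real.log n / n : ℝ) : ℂ) * χ n‖
    + q * (Real.log (2 + 1 : ℕ) / (2 + 1 : ℕ)), fun N => ?_⟩
  rcases le_total N 2 with h | h
  · refine (norm_sum_le _ _).trans (le_add_of_le_of_nonneg
      (Finset.sum_le_sum_of_subset_of_nonneg (Finset.Ioc_subset_Ioc_right h)
      fun _ _ _ => norm_nonneg _) (mul_nonneg (Nat.cast_nonneg _) (hpos _)))
  · rw [← Finset.sum_Ioc_consecutive _ (Nat.zero_le _) h]
    exact (norm_add_le _ _).trans (add_le_add (norm_sum_le _ _) (h2 N))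

open ArithmeticFunction in
lemma sum_Ioc_vonMangoldt_le (N : ℕ) :
    ∑ n ∈ Finset.Ioc 0 N, vonMangoldt n ≤ (Real.log 4 + 4) * N := by
  simpa [Chebyshev.psi] using Chebyshev.psi_le_const_mul_self (Nat.cast_nonneg (α := ℝ) N)

open ArithmeticFunction in
lemma DirichletCharacter.sum_log_div_eq {q : ℕ} (χ : DirichletCharacter ℂ q) (N : ℕ) :
    ∑ n ∈ Finset.Ioc 0 N, ((Real.log n / n : ℝ) : ℂ) * χ n
      = ∑ d ∈ Finset.Ioc 0 N, ((vonMangoldt d / d : ℝ) : ℂ) * χ d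
          * ∑ n ∈ Finset.Ioc 0 (N / d), χ n / n := by
  let f : ArithmeticFunction ℂ := ⟨fun d => ((vonMangoldt d / d : ℝ) : ℂ) * χ d, by simp⟩
  let g : ArithmeticFunction ℂ := ⟨fun n => χ n / n, by simp⟩
  refine Eq.trans (Finset.sum_congr rfl fun n _ => ?_) (sum_Ioc_mul_eq_sum_sum f g N)
  rw [mul_apply, ← vonMangoldt_sum,
    ← Nat.sum_divisorsAntidiagonal (fun i _ => vonMangoldt i)]
  push_cast
  rw [Finset.sum_div, Finset.sum_mul]
  refine Finset.sum_congr rfl fun x hx => ?_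
  rw [← (Nat.mem_divisorsAntidiagonal.1 hx).1]
  change _ = ((vonMangoldt x.1 / x.1 : ℝ) : ℂ) * χ x.1 * (χ x.2 / x.2)
  push_cast
  rw [map_mul]
  ring

open ArithmeticFunction in
lemma DirichletCharacter.exists_norm_sum_vonMangoldt_div_le {q : ℕ} [NeZero q]
    {χ : DirichletCharacter ℂ q} (hχ : χ ≠ 1) :
    ∃ C : ℝ, ∀ N : ℕ, ‖∑ n ∈ Finset.Ioc 0 N, ((vonMangoldt n / n : ℝ) : ℂ) * χ n‖ ≤ C := by
  obtain ⟨C, hC⟩ := exists_norm_sum_log_div_le hχ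
  have hL : 0 < ‖LFunction χ 1‖ := norm_pos_iff.2 (LFunction_apply_one_ne_zero hχ)
  refine ⟨(C + q * (Real.log 4 + 4)) / ‖LFunction χ 1‖, fun N => ?_⟩
  rw [le_div_iff₀ hL, ← norm_mul]
  have hsplit : (∑ n ∈ Finset.Ioc 0 N, ((vonMangoldt n / n : ℝ) : ℂ) * χ n) * LFunction χ 1
      = ∑ n ∈ Finset.Ioc 0 N, ((Real.log n / n : ℝ) : ℂ) * χ n
        + ∑ d ∈ Finset.Ioc 0 N, ((vonMangoldt d / d : ℝ) : ℂ) * χ d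
          * (LFunction χ 1 - ∑ n ∈ Finset.Ioc 0 (N / d), χ n / n) := by
    rw [χ.sum_log_div_eq, Finset.sum_mul, ← Finset.sum_add_distrib]
    exact Finset.sum_congr rfl fun _ _ => by ring
  rw [hsplit]
  refine (norm_add_le _ _).trans (add_le_add (hC N) ?_)
  rcases Nat.eq_zero_or_pos N with rfl | hN
  · simp only [Finset.Ioc_self, Finset.sum_empty, norm_zero]
    positivity
  have hN' : (0 : ℝ) < N := by exact_mod_cast hN
  calc _ ≤ ∑ d ∈ Finset.Ioc 0 N, q / N * vonMangoldt d := by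
        refine (norm_sum_le _ _).trans (Finset.sum_le_sum fun d hd => ?_)
        have hd0 : (0 : ℝ) < d := by exact_mod_cast (Finset.mem_Ioc.1 hd).1
        have hlt : (N : ℝ) ≤ d * ((N / d : ℕ) + 1) := by
          exact_mod_cast (Nat.lt_mul_div_succ N (Finset.mem_Ioc.1 hd).1).le
        rw [norm_mul, norm_mul, Complex.norm_real, Real.norm_of_nonneg
          (div_nonneg vonMangoldt_nonneg hd0.le)]
        calc _ ≤ vonMangoldt d / d * 1 * (q / ((N / d : ℕ) + 1)) := by
              refine mul_le_mul (mul_le_mul_of_nonneg_left (χ.norm_le_one _) ?_)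
                (norm_LFunction_one_sub_sum_le hχ _) (norm_nonneg _) ?_
              all_goals
                have := vonMangoldt_nonneg (n := d)
                positivity
          _ = q / (d * ((N / d : ℕ) + 1)) * vonMangoldt d := by field_simp
          _ ≤ _ := mul_le_mul_of_nonneg_right
              (div_le_div_of_nonneg_left (Nat.cast_nonneg _) hN' hlt) vonMangoldt_nonneg
    _ = q / N * ∑ d ∈ Finset.Ioc 0 N, vonMangoldt d := by rw [Finset.mul_sum]
    _ ≤ q / N * ((Real.log 4 + 4) * N) :=
        mul_le_mul_of_nonneg_left (sum_Ioc_vonMangoldt_le N) (by positivity)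
    _ = q * (Real.log 4 + 4) := by field_simp

/-- Mertens' estimate. -/
lemma exists_abs_sum_vonMangoldt_div_sub_log_le :
    ∃ C : ℝ, ∀ N : ℕ, 0 < N →
      |∑ n ∈ Finset.Ioc 0 N, ArithmeticFunction.vonMangoldt n / n - Real.log N| ≤ C := by
  refine ⟨Real.log 4 + 4 + 1, fun N hN => ?_⟩
  have hN' : (0 : ℝ) < N := by exact_mod_cast hN
  have hfac : Real.log N.factorial
      = ∑ d ∈ Finset.Ioc 0 N, ArithmeticFunction.vonMangoldt d * ((N / d : ℕ) : ℝ) := by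
    rw [← ArithmeticFunction.sum_Ioc_mul_zeta_eq_sum, ArithmeticFunction.vonMangoldt_mul_zeta]
    simp only [ArithmeticFunction.log_apply]
    rw [← Finset.prod_Ico_id_eq_factorial]
    push_cast
    rw [Real.log_prod]
    · exact Finset.sum_congr (by ext; simp; lia) fun _ _ => rfl
    · intro i hi
      have := (Finset.mem_Ico.1 hi).1
      positivity
  have hlo := Stirling.le_log_factorial_stirling hN.ne'
  have hhi : Real.log N.factorial ≤ N * Real.log N := by
    rw [← Real.log_pow]
    exact Real.log_le_log (by positivity) (by exact_mod_cast Nat.factorial_le_pow N)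
  have hup : Real.log N.factorial
      ≤ N * ∑ n ∈ Finset.Ioc 0 N, ArithmeticFunction.vonMangoldt n / n := by
    rw [hfac, Finset.mul_sum]
    refine Finset.sum_le_sum fun d hd => ?_
    rw [mul_div_left_comm]
    exact mul_le_mul_of_nonneg_left Nat.cast_div_le ArithmeticFunction.vonMangoldt_nonneg
  have hdown : N * ∑ n ∈ Finset.Ioc 0 N, ArithmeticFunction.vonMangoldt n / n
      ≤ Real.log N.factorial + (Real.log 4 + 4) * N := by
    refine le_trans ?_ (add_le_add_right (sum_Ioc_vonMangoldt_le N) _)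
    rw [hfac, Finset.mul_sum, ← Finset.sum_add_distrib]
    refine Finset.sum_le_sum fun d hd => ?_
    have hd0 : (0 : ℝ) < d := by exact_mod_cast (Finset.mem_Ioc.1 hd).1
    have hlt : (N : ℝ) ≤ d * ((N / d : ℕ) + 1) := by
      exact_mod_cast (Nat.lt_mul_div_succ N (Finset.mem_Ioc.1 hd).1).le
    rw [mul_div_left_comm, ← mul_add_one]
    exact mul_le_mul_of_nonneg_left ((div_le_iff₀' hd0).2 hlt) ArithmeticFunction.vonMangoldt_nonneg
  have h1 : 0 ≤ Real.log N := Real.log_natCast_nonneg N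
  have h2 : 0 ≤ Real.log (2 * Real.pi) := Real.log_nonneg (by linarith [Real.pi_gt_three])
  have h4 : 0 ≤ Real.log 4 := Real.log_nonneg (by norm_num)
  rw [abs_le]
  constructor <;> nlinarith

open ArithmeticFunction in
lemma DirichletCharacter.exists_norm_sum_vonMangoldt_div_sub_le {q : ℕ} [NeZero q]
    [DecidableEq (DirichletCharacter ℂ q)] (χ : DirichletCharacter ℂ q) :
    ∃ C : ℝ, ∀ N : ℕ, 0 < N → ‖∑ n ∈ Finset.Ioc 0 N, ((vonMangoldt n / n : ℝ) : ℂ) * χ n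
      - if χ = 1 then (Real.log N : ℂ) else 0‖ ≤ C := by
  by_cases hχ : χ = 1
  · subst hχ
    obtain ⟨C, hC⟩ := exists_abs_sum_vonMangoldt_div_sub_log_le
    have hsum := vonMangoldt.summable_residueClass_non_primes_div (q := 1) 0
    set b : ℕ → ℝ := fun n => (if n.Prime then 0 else vonMangoldt.residueClass (q := 1) 0 n) / n
    have hb0 : ∀ n, 0 ≤ b n := fun n => by
      have := vonMangoldt.residueClass_nonneg (q := 1) 0 n
      simp only [b]
      positivity
    refine ⟨∑ n ∈ q.divisors, vonMangoldt n / n + ∑' n, b n + C, fun N hN => ?_⟩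
    rw [if_pos rfl]
    have hsplit : ∑ n ∈ Finset.Ioc 0 N, ((vonMangoldt n / n : ℝ) : ℂ)
          * (1 : DirichletCharacter ℂ q) n - (Real.log N : ℂ)
        = ∑ n ∈ Finset.Ioc 0 N, ((vonMangoldt n / n : ℝ) : ℂ)
            * ((1 : DirichletCharacter ℂ q) n - 1)
          + ((∑ n ∈ Finset.Ioc 0 N, vonMangoldt n / n - Real.log N : ℝ) : ℂ) := by
      simp only [mul_sub, mul_one, Finset.sum_sub_distrib]
      push_cast
      ring
    rw [hsplit]
    refine (norm_add_le _ _).trans (add_le_add ?_ ?_)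
    · have hterm : ∀ n ∈ Finset.Ioc 0 N,
          ‖((vonMangoldt n / n : ℝ) : ℂ) * ((1 : DirichletCharacter ℂ q) n - 1)‖
            ≤ (if n ∈ q.divisors then vonMangoldt n / n else 0) + b n := by
        intro n hn
        have hΛ : 0 ≤ vonMangoldt n / n := div_nonneg vonMangoldt_nonneg (Nat.cast_nonneg n)
        have hif : 0 ≤ if n ∈ q.divisors then vonMangoldt n / n else 0 := by
          split_ifs <;> simp [hΛ]
        by_cases hu : IsUnit (n : ZMod q)
        · rw [MulChar.one_apply hu]
          simpa using add_nonneg hif (hb0 n)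
        · rw [MulChar.map_nonunit _ hu, zero_sub, mul_neg, mul_one, norm_neg, Complex.norm_real,
            Real.norm_of_nonneg hΛ]
          by_cases hp : n.Prime
          · rw [if_pos]
            · exact le_add_of_nonneg_right (hb0 n)
            · rw [ZMod.isUnit_iff_coprime, hp.coprime_iff_not_dvd, not_not] at hu
              exact Nat.mem_divisors.2 ⟨hu, NeZero.ne q⟩
          · refine le_add_of_nonneg_of_le hif (le_of_eq ?_)
            simp only [b, if_neg hp]
            rw [vonMangoldt.residueClass,
              Set.indicator_of_mem (show n ∈ {n : ℕ | (n : ZMod 1) = 0} from Subsingleton.elim _ _)]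
      refine (norm_sum_le _ _).trans ((Finset.sum_le_sum hterm).trans ?_)
      rw [Finset.sum_add_distrib]
      refine add_le_add ?_ (hsum.sum_le_tsum _ fun n _ => hb0 n)
      rw [← Finset.sum_filter]
      refine Finset.sum_le_sum_of_subset_of_nonneg (fun n hn => (Finset.mem_filter.1 hn).2)
        fun n _ _ => div_nonneg vonMangoldt_nonneg (Nat.cast_nonneg n)
    · rw [Complex.norm_real]
      exact hC N hN
  · obtain ⟨C, hC⟩ := exists_norm_sum_vonMangoldt_div_le hχ
    exact ⟨C, fun N _ => by simpa [hχ] using hC N⟩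

open ArithmeticFunction in
/-- Mertens' estimate for the residue class of `1`. -/
lemma exists_abs_sum_residueClass_div_sub_log_le (q : ℕ) [NeZero q] :
    ∃ C : ℝ, ∀ N : ℕ, 0 < N →
      |∑ n ∈ Finset.Ioc 0 N, vonMangoldt.residueClass (1 : ZMod q) n / n
        - (q.totient : ℝ)⁻¹ * Real.log N| ≤ C := by
  classical
  choose C hC using fun χ : DirichletCharacter ℂ q => χ.exists_norm_sum_vonMangoldt_div_sub_le
  refine ⟨(q.totient : ℝ)⁻¹ * ∑ χ, C χ, fun N hN => ?_⟩
  have heq : ((∑ n ∈ Finset.Ioc 0 N, vonMangoldt.residueClass (1 : ZMod q) n / n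
        - (q.totient : ℝ)⁻¹ * Real.log N : ℝ) : ℂ)
      = (q.totient : ℂ)⁻¹ * ∑ χ : DirichletCharacter ℂ q,
        (∑ n ∈ Finset.Ioc 0 N, ((vonMangoldt n / n : ℝ) : ℂ) * χ n
          - if χ = 1 then (Real.log N : ℂ) else 0) := by
    rw [Finset.sum_sub_distrib, Finset.sum_ite_eq', if_pos (Finset.mem_univ _), Finset.sum_comm,
      mul_sub, Finset.mul_sum]
    push_cast
    congr 1
    refine Finset.sum_congr rfl fun n _ => ?_
    rw [vonMangoldt.residueClass_apply isUnit_one, mul_div_assoc, Finset.sum_div]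
    congr 1
    refine Finset.sum_congr rfl fun χ _ => ?_
    rw [ZMod.inv_one, map_one]
    ring
  rw [← Real.norm_eq_abs, ← Complex.norm_real, heq, norm_mul, norm_inv, Complex.norm_natCast]
  exact mul_le_mul_of_nonneg_left ((norm_sum_le _ _).trans
    (Finset.sum_le_sum fun χ _ => hC χ N hN)) (by positivity)

open ArithmeticFunction in
lemma exists_abs_sum_prime_div_sub_log_le (q : ℕ) [NeZero q] :
    ∃ C : ℝ, ∀ N : ℕ, 0 < N →
      |∑ n ∈ Finset.Ioc 0 N, (if n.Prime then vonMangoldt.residueClass (1 : ZMod q) n else 0) / n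
        - (q.totient : ℝ)⁻¹ * Real.log N| ≤ C := by
  obtain ⟨C, hC⟩ := exists_abs_sum_residueClass_div_sub_log_le q
  have hsum := vonMangoldt.summable_residueClass_non_primes_div (1 : ZMod q)
  set b : ℕ → ℝ := fun n => (if n.Prime then 0 else vonMangoldt.residueClass (1 : ZMod q) n) / n
  have hb0 : ∀ n, 0 ≤ b n := fun n => by
    have := vonMangoldt.residueClass_nonneg (1 : ZMod q) n
    simp only [b]
    positivity
  refine ⟨C + ∑' n, b n, fun N hN => ?_⟩
  have hsplit : ∑ n ∈ Finset.Ioc 0 N,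
        (if n.Prime then vonMangoldt.residueClass (1 : ZMod q) n else 0) / n
      = ∑ n ∈ Finset.Ioc 0 N, vonMangoldt.residueClass (1 : ZMod q) n / n
        - ∑ n ∈ Finset.Ioc 0 N, b n := by
    rw [← Finset.sum_sub_distrib]
    refine Finset.sum_congr rfl fun n _ => ?_
    simp only [b]
    split_ifs <;> simp
  rw [hsplit, sub_right_comm]
  refine (abs_sub _ _).trans (add_le_add (hC N hN) ?_)
  rw [abs_of_nonneg (Finset.sum_nonneg fun n _ => hb0 n)]
  exact hsum.sum_le_tsum _ fun n _ => hb0 n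

open ArithmeticFunction in
/-- A Chebyshev lower bound for the primes congruent to `1` modulo `q`. -/
lemma exists_le_mul_sum_log_prime_modEq_one (q : ℕ) [NeZero q] :
    ∃ A : ℕ, 0 < A ∧ ∀ N : ℕ, A ≤ N →
      (N : ℝ) ≤ A * ∑ p ∈ Finset.Ioc 0 N with p.Prime ∧ p ≡ 1 [MOD q], Real.log p := by
  obtain ⟨C, hC⟩ := exists_abs_sum_prime_div_sub_log_le q
  have hq : (0 : ℝ) < q.totient := by exact_mod_cast Nat.totient_pos.2 (NeZero.pos q)
  obtain ⟨A, hA1, hA⟩ : ∃ A : ℕ, 0 < A ∧ q.totient * (2 * C + 1) ≤ Real.log A := by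
    have := (Real.tendsto_log_atTop.comp tendsto_natCast_atTop_atTop).eventually_ge_atTop
      (q.totient * (2 * C + 1))
    obtain ⟨A, h1, h2⟩ := ((Filter.eventually_gt_atTop 0).and this).exists
    exact ⟨A, h1, h2⟩
  refine ⟨A, hA1, fun N hN => ?_⟩
  set w : ℕ → ℝ := fun n => if n.Prime then vonMangoldt.residueClass (1 : ZMod q) n else 0 with hw
  have hw0 : ∀ n, 0 ≤ w n := fun n => by
    have := vonMangoldt.residueClass_nonneg (1 : ZMod q) n
    simp only [w]
    positivity
  have hθ : ∑ p ∈ Finset.Ioc 0 N with p.Prime ∧ p ≡ 1 [MOD q], Real.log p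
      = ∑ n ∈ Finset.Ioc 0 N, w n := by
    rw [Finset.sum_filter]
    refine Finset.sum_congr rfl fun n _ => ?_
    have h1 : n ≡ 1 [MOD q] ↔ (n : ZMod q) = 1 := by
      rw [← ZMod.natCast_eq_natCast_iff, Nat.cast_one]
    by_cases hp : n.Prime
    · simp [w, hp, h1, Set.indicator_apply, vonMangoldt_apply_prime hp]
    · simp [w, hp]
  have hM : 0 < N / A := Nat.div_pos hN hA1
  have hA0 : (0 : ℝ) < A := by exact_mod_cast hA1
  have hN0 : (0 : ℝ) < N := by exact_mod_cast hA1.trans_le hN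
  have hlog : Real.log A ≤ Real.log N - Real.log (N / A : ℕ) := by
    have hM0 : (0 : ℝ) < (N / A : ℕ) := by exact_mod_cast hM
    rw [le_sub_iff_add_le, ← Real.log_mul hA0.ne' hM0.ne']
    exact Real.log_le_log (by positivity) (by exact_mod_cast Nat.mul_div_le N A)
  have hκ : 2 * C + 1 ≤ (q.totient : ℝ)⁻¹ * Real.log A := (le_inv_mul_iff₀ hq).2 hA
  have hgap : 1 ≤ ∑ n ∈ Finset.Ioc (N / A) N, w n / n := by
    have h1 := abs_le.1 (hC N (hA1.trans_le hN))
    have h2 := abs_le.1 (hC _ hM)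
    rw [← Finset.sum_Ioc_consecutive _ (Nat.zero_le _) (Nat.div_le_self N A)] at h1
    have h3 := mul_le_mul_of_nonneg_left hlog (inv_nonneg.2 hq.le)
    simp only [w]
    linarith [h1.1, h2.2]
  have hupper : ∑ n ∈ Finset.Ioc (N / A) N, w n / n ≤ ∑ n ∈ Finset.Ioc 0 N, A / N * w n := by
    refine (Finset.sum_le_sum fun n hn => ?_).trans (Finset.sum_le_sum_of_subset_of_nonneg
      (Finset.Ioc_subset_Ioc_left (Nat.zero_le _)) fun n _ _ => mul_nonneg (by positivity) (hw0 n))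
    have hn0 : N < n * A := (Nat.div_lt_iff_lt_mul hA1).1 (Finset.mem_Ioc.1 hn).1
    have hn1 : (0 : ℝ) < n := by exact_mod_cast (Nat.zero_le _).trans_lt (Finset.mem_Ioc.1 hn).1
    rw [div_eq_inv_mul]
    refine mul_le_mul_of_nonneg_right ?_ (hw0 n)
    rw [inv_le_iff_one_le_mul₀ hn1, div_mul_eq_mul_div, le_div_iff₀ hN0, one_mul, mul_comm]
    exact_mod_cast hn0.le
  rw [hθ]
  have := hgap.trans hupper
  rwa [← Finset.mul_sum, div_mul_eq_mul_div, le_div_iff₀ hN0, one_mul] at this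

lemma exists_prime_modEq_one_not_dvd (q : ℕ) [NeZero q] :
    ∃ A : ℕ, ∀ N : ℕ, A ≤ N → ∀ z : ℤ, z ≠ 0 → A * Real.log |(z : ℝ)| < N →
      ∃ p ≤ N, p.Prime ∧ p ≡ 1 [MOD q] ∧ ¬ (p : ℤ) ∣ z := by
  obtain ⟨A, _, hA⟩ := exists_le_mul_sum_log_prime_modEq_one q
  refine ⟨A, fun N hN z hz hlt => ?_⟩
  by_contra! hdvd
  refine (hA N hN).not_gt (lt_of_le_of_lt ?_ hlt)
  refine mul_le_mul_of_nonneg_left ?_ (Nat.cast_nonneg A)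
  set P := (Finset.Ioc 0 N).filter fun p => p.Prime ∧ p ≡ 1 [MOD q] with hP
  have hprod : ∏ p ∈ P, p ∣ z.natAbs := by
    refine Finset.prod_primes_dvd _ (fun p hp => (Finset.mem_filter.1 hp).2.1.prime) fun p hp => ?_
    obtain ⟨hpN, hpp, hpq⟩ := Finset.mem_filter.1 hp
    exact Int.natCast_dvd.1 (hdvd p (Finset.mem_Ioc.1 hpN).2 hpp hpq)
  have hpos : ∀ p ∈ P, 0 < p := fun p hp => (Finset.mem_filter.1 hp).2.1.pos
  rw [← Real.log_prod fun p hp => by exact_mod_cast (hpos p hp).ne']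
  refine Real.log_le_log (Finset.prod_pos fun p hp => by exact_mod_cast hpos p hp) ?_
  rw [← Int.cast_abs, ← Nat.cast_natAbs, ← Nat.cast_prod]
  exact Nat.cast_le.2 (Nat.le_of_dvd (Int.natAbs_pos.2 hz) hprod)

lemma exists_abs_apply_le_of_mem_addWordBall {m : ℕ} (S : Finset (Fin m → ℤ)) :
    ∃ B : ℝ, 0 ≤ B ∧ ∀ r : ℝ, ∀ v ∈ addWordBall S r, ∀ i, |(v i : ℝ)| ≤ B * r := by
  refine ⟨∑ s ∈ S, ∑ i, |(s i : ℝ)|, by positivity, ?_⟩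
  rintro r v ⟨l, hl, hlen, rfl⟩ i
  have hgen : ∀ s ∈ S, |(s i : ℝ)| ≤ ∑ s ∈ S, ∑ i, |(s i : ℝ)| := fun s hs =>
    (Finset.single_le_sum (f := fun i => |(s i : ℝ)|) (fun _ _ => abs_nonneg _)
      (Finset.mem_univ i)).trans
      (Finset.single_le_sum (f := fun s : Fin m → ℤ => ∑ i, |(s i : ℝ)|)
        (fun _ _ => by positivity) hs)
  refine le_trans ?_ (mul_le_mul_of_nonneg_left hlen (by positivity))
  clear hlen
  induction l with
  | nil => simp
  | cons x l ih =>
    have hx : |(x i : ℝ)| ≤ ∑ s ∈ S, ∑ i, |(s i : ℝ)| := by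
      rcases hl x (by simp) with h | h
      · exact hgen x h
      · simpa using hgen (-x) h
    have hl := ih fun y hy => hl y (List.mem_cons_of_mem _ hy)
    rw [List.sum_cons, Pi.add_apply, List.length_cons]
    push_cast
    refine (abs_add_le _ _).trans ?_
    linarith

/-- if every irreducible `ℂ`-subrepresentation of the integral
representation `φ : H → GL(m,ℤ)` has dimension at most `k`, then
`RF_{ℤ^m, Inv(φ)} ⪯ log^k`. -/
theorem stmt_9 {H : Type*} [Group H] [Fintype H] {m : ℕ}
    (φ : H →* Matrix.GeneralLinearGroup (Fin m) ℤ)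
    (S : Finset (Fin m → ℤ)) (hS : AddSubgroup.closure (S : Set (Fin m → ℤ)) = ⊤)
    (k : ℕ)
    (hk : ∀ W : Submodule ℂ (Fin m → ℂ),
      IsIrredC (fun h => (φ h : Matrix (Fin m) (Fin m) ℤ)) W → Module.finrank ℂ W ≤ k) :
    GrowthLE (addRF (InvSet φ) S) (fun r => (Real.log r) ^ k) := by
  obtain ⟨A, hA⟩ := exists_prime_modEq_one_not_dvd (Nat.card H)
  obtain ⟨B, hB0, hB⟩ := exists_abs_apply_le_of_mem_addWordBall S
  set C : ℝ := (2 * A + 1) ^ k + B + Real.exp 1 with hCdef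
  have hpow : (0 : ℝ) < (2 * A + 1) ^ k := by positivity
  have hexp := Real.exp_pos 1
  have hC : 0 < C := by positivity
  refine ⟨C, hC, fun r hr => ?_⟩
  have hr1 : 1 ≤ r := (le_max_left _ _).trans hr
  have hlog : 1 ≤ Real.log (C * r) := by
    rw [Real.le_log_iff_exp_le (by positivity)]
    nlinarith
  have hbound : ((2 * A + 1) * Real.log (C * r)) ^ k ≤ C * Real.log (C * r) ^ k := by
    rw [mul_pow]
    exact mul_le_mul_of_nonneg_right (by linarith) (by positivity)
  refine csSup_le (Set.insert_nonempty _ _) ?_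
  rintro _ (rfl | ⟨v, ⟨hv, hv0⟩, rfl⟩)
  · refine le_trans (one_le_pow₀ ?_) hbound
    nlinarith [(Nat.cast_nonneg A : (0 : ℝ) ≤ A)]
  · obtain ⟨i, hi⟩ := Function.ne_iff.1 hv0
    set N : ℕ := ⌊A * Real.log (C * r)⌋₊ + 1 + A with hN
    have hNle : (N : ℝ) ≤ (2 * A + 1) * Real.log (C * r) := by
      have := Nat.floor_le (by positivity : 0 ≤ A * Real.log (C * r))
      rw [hN]
      push_cast
      nlinarith [(Nat.cast_nonneg A : (0 : ℝ) ≤ A)]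
    have hlt : A * Real.log |(v i : ℝ)| < N := by
      have hle : Real.log |(v i : ℝ)| ≤ Real.log (C * r) := by
        refine Real.log_le_log (abs_pos.2 (by exact_mod_cast hi)) ((hB r v hv i).trans ?_)
        exact mul_le_mul_of_nonneg_right (by linarith) (by linarith)
      have := Nat.lt_floor_add_one (A * Real.log (C * r))
      have := mul_le_mul_of_nonneg_left hle (Nat.cast_nonneg (α := ℝ) A)
      rw [hN]
      push_cast
      linarith [(Nat.cast_nonneg A : (0 : ℝ) ≤ A)]
    obtain ⟨p, hpN, hp, hpq, hdvd⟩ := hA N (Nat.le_add_left _ _) (v i) hi hlt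
    obtain ⟨M, hM, hvM, hindex⟩ := exists_invSet_index_le φ k hk hp hpq v i hdvd
    have hdiv : (addDivFn (InvSet φ) v).toNat ≤ M.index :=
      ENat.toNat_le_of_le_natCast (sInf_le ⟨M, hM, hvM, rfl⟩)
    calc ((addDivFn (InvSet φ) v).toNat : ℝ) ≤ (p ^ k : ℕ) := by exact_mod_cast hdiv.trans hindex
      _ = (p : ℝ) ^ k := by push_cast; rfl
      _ ≤ ((2 * A + 1) * Real.log (C * r)) ^ k :=
          pow_le_pow_left₀ (Nat.cast_nonneg p) (le_trans (by exact_mod_cast hpN) hNle) k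
      _ ≤ _ := hbound
end

section
/- Let φ : H → GL(m,ℤ) be an integral representation of a finite group H, and let ℚ^m = W_1 ⊕ ⋯ ⊕ W_n be a decomposition into irreducible ℚ-subrepresentations W_i of φ, with natural projections P_i : ℚ^m → W_i and restricted representations φ_i : H → Aut(K_i), where K_i = P_i(ℤ^m). Then RF_{ℤ^m, Inv(φ), B_{ℤ^m}} ≈ max{RF_{K_i, Inv(φ_i), B_i} : 1 ≤ i ≤ n} (for any choice of word metrics B_i on the finitely generated free abelian groups K_i). -/
/-- The inclusion `ℤ^m → ℚ^m`. -/
def castHom (m : ℕ) : (Fin m → ℤ) →+ (Fin m → ℚ) where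
  toFun v := fun i => (v i : ℚ)
  map_zero' := by funext i; simp
  map_add' v w := by funext i; simp

/-- The endomorphism of `ℚ^m` given by an integer matrix. -/
def ratAct {m : ℕ} (M : Matrix (Fin m) (Fin m) ℤ) : (Fin m → ℚ) →+ (Fin m → ℚ) :=
  (M.map (Int.cast : ℤ → ℚ)).mulVecLin.toAddMonoidHom

/-- `K_i = P_i(ℤ^m)`: the image of the integer lattice under a projection
`p : ℚ^m → ℚ^m`. -/
def Ki {m : ℕ} (p : (Fin m → ℚ) →ₗ[ℚ] (Fin m → ℚ)) : AddSubgroup (Fin m → ℚ) :=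
  ((castHom m).range).map p.toAddMonoidHom

/-- `Inv(φᵢ)`: the finite-index subgroups of `K' ⊆ ℚ^m` invariant under the restricted
representation (expressed in the ambient space `ℚ^m`). -/
def InvSub {H : Type*} [Group H] {m : ℕ} (K' : AddSubgroup (Fin m → ℚ))
    (φ : H →* Matrix.GeneralLinearGroup (Fin m) ℤ) : Set (AddSubgroup K') :=
  {N | N.FiniteIndex ∧ ∀ h : H,
    (N.map K'.subtype).map (ratAct ((φ h : Matrix (Fin m) (Fin m) ℤ))) =
      N.map K'.subtype}

/-- A `ℚ`-subspace `W ⊆ ℚ^m` is invariant under the family of integer matrices `ρ`. -/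
def InvariantQ {H : Type*} {m : ℕ} (ρ : H → Matrix (Fin m) (Fin m) ℤ)
    (W : Submodule ℚ (Fin m → ℚ)) : Prop :=
  ∀ h : H, ∀ v ∈ W, ((ρ h).map (Int.cast : ℤ → ℚ)).mulVec v ∈ W

/-- `W` is an irreducible `ℚ`-subrepresentation: nonzero, invariant, and containing
no proper nonzero invariant subspace. -/
def IsIrredQ {H : Type*} {m : ℕ} (ρ : H → Matrix (Fin m) (Fin m) ℤ)
    (W : Submodule ℚ (Fin m → ℚ)) : Prop :=
  W ≠ ⊥ ∧ InvariantQ ρ W ∧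
    ∀ W' : Submodule ℚ (Fin m → ℚ), W' ≤ W → W' ≠ ⊥ → InvariantQ ρ W' → W' = W

section WordBall

variable {A B : Type*} [AddCommGroup A] [AddCommGroup B]

lemma addWordBall_mono (S : Finset A) {r r' : ℝ} (h : r ≤ r') :
    addWordBall S r ⊆ addWordBall S r' := by
  rintro a ⟨l, hl, hr, rfl⟩
  exact ⟨l, hl, hr.trans h, rfl⟩

lemma add_mem_addWordBall {S : Finset A} {r r' : ℝ} {a b : A} (ha : a ∈ addWordBall S r)
    (hb : b ∈ addWordBall S r') : a + b ∈ addWordBall S (r + r') := by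
  obtain ⟨l, hl, hr, rfl⟩ := ha
  obtain ⟨l', hl', hr', rfl⟩ := hb
  refine ⟨l ++ l', fun x hx => ?_, ?_, by simp⟩
  · rcases List.mem_append.1 hx with h | h
    exacts [hl x h, hl' x h]
  · push_cast [List.length_append]
    linarith

lemma neg_mem_addWordBall {S : Finset A} {r : ℝ} {a : A} (ha : a ∈ addWordBall S r) :
    -a ∈ addWordBall S r := by
  obtain ⟨l, hl, hr, rfl⟩ := ha
  refine ⟨l.map (fun x => -x), fun x hx => ?_, by simpa using hr, ?_⟩
  · obtain ⟨y, hy, rfl⟩ := List.mem_map.1 hx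
    simpa using (hl y hy).symm
  · exact (List.sum_neg l).symm

lemma addWordBall_finite (S : Finset A) (r : ℝ) : (addWordBall S r).Finite := by
  have hfin : Finite {x : A // x ∈ S ∨ -x ∈ S} := by
    have : {x : A | x ∈ S ∨ -x ∈ S}.Finite :=
      S.finite_toSet.union (S.finite_toSet.preimage neg_injective.injOn)
    exact this.to_subtype
  refine ((List.finite_length_le {x : A // x ∈ S ∨ -x ∈ S} ⌊r⌋₊).image
    (fun l => (l.map Subtype.val).sum)).subset ?_
  rintro a ⟨l, hl, hr, rfl⟩
  lift l to List {x : A // x ∈ S ∨ -x ∈ S} using hl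
  refine ⟨l, ?_, rfl⟩
  simpa using Nat.le_floor hr

lemma exists_mem_addWordBall {T : Finset B} (hT : AddSubgroup.closure (T : Set B) = ⊤) (b : B) :
    ∃ c : ℝ, b ∈ addWordBall T c := by
  have hb : b ∈ AddSubgroup.closure (T : Set B) := hT ▸ AddSubgroup.mem_top b
  induction hb using AddSubgroup.closure_induction with
  | mem x hx => exact ⟨1, [x], by simpa using Or.inl hx, by simp, by simp⟩
  | zero => exact ⟨0, [], by simp, by simp, by simp⟩
  | add x y _ _ hx hy =>
    obtain ⟨c, hc⟩ := hx
    obtain ⟨d, hd⟩ := hy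
    exact ⟨c + d, add_mem_addWordBall hc hd⟩
  | neg x _ hx =>
    obtain ⟨c, hc⟩ := hx
    exact ⟨c, neg_mem_addWordBall hc⟩

/-- Homomorphisms between finitely generated groups are Lipschitz for the word metrics. -/
lemma exists_map_mem_addWordBall (f : A →+ B) (S : Finset A) {T : Finset B}
    (hT : AddSubgroup.closure (T : Set B) = ⊤) :
    ∃ C : ℝ, 1 ≤ C ∧ ∀ r, ∀ a ∈ addWordBall S r, f a ∈ addWordBall T (C * r) := by
  choose c hc using exists_mem_addWordBall hT
  obtain ⟨M, hM⟩ := ((S.finite_toSet.image fun s => c (f s))).bddAbove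
  have hC : ∀ x, (x ∈ S ∨ -x ∈ S) → f x ∈ addWordBall T (max 1 M) := by
    have key : ∀ x ∈ S, f x ∈ addWordBall T (max 1 M) := fun x hx =>
      addWordBall_mono T ((hM ⟨x, hx, rfl⟩).trans (le_max_right _ _)) (hc (f x))
    rintro x (hx | hx)
    · exact key x hx
    · simpa using neg_mem_addWordBall (key _ hx)
  refine ⟨max 1 M, le_max_left _ _, ?_⟩
  rintro r a ⟨l, hl, hr, rfl⟩
  refine addWordBall_mono T (mul_le_mul_of_nonneg_left hr (by positivity)) ?_
  clear hr
  induction l with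
  | nil => exact ⟨[], by simp, by simp, by simp⟩
  | cons x l ih =>
    have h := add_mem_addWordBall (hC x (hl x (by simp)))
      (ih fun y hy => hl y (List.mem_cons_of_mem _ hy))
    rw [List.sum_cons, map_add]
    convert h using 2
    push_cast [List.length_cons]
    ring

end WordBall

section Divisibility

variable {A B : Type*} [AddCommGroup A] [AddCommGroup B]

lemma addDivFn_ne_top {P : Set (AddSubgroup A)} {a : A} {N : AddSubgroup A} (hN : N ∈ P)
    (ha : a ∉ N) : addDivFn P a ≠ ⊤ :=
  ne_top_of_le_ne_top (ENat.natCast_ne_top N.index) (sInf_le ⟨N, hN, ha, rfl⟩)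

lemma bddAbove_addRF (P : Set (AddSubgroup A)) (S : Finset A) (r : ℝ) :
    BddAbove (insert 1 ((fun a => ((addDivFn P a).toNat : ℝ)) '' (addWordBall S r \ {0}))) :=
  ((((addWordBall_finite S r).sdiff).image _).insert _).bddAbove

lemma one_le_addRF (P : Set (AddSubgroup A)) (S : Finset A) (r : ℝ) : 1 ≤ addRF P S r :=
  le_csSup (bddAbove_addRF P S r) (Set.mem_insert _ _)

lemma addDivFn_le_addRF (P : Set (AddSubgroup A)) {S : Finset A} {r : ℝ} {a : A}
    (ha : a ∈ addWordBall S r) (h0 : a ≠ 0) : ((addDivFn P a).toNat : ℝ) ≤ addRF P S r :=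
  le_csSup (bddAbove_addRF P S r) (Set.mem_insert_of_mem _ ⟨a, ⟨ha, h0⟩, rfl⟩)

lemma addRF_le (P : Set (AddSubgroup A)) {S : Finset A} {r c : ℝ} (hc : 1 ≤ c)
    (h : ∀ a ∈ addWordBall S r, a ≠ 0 → ((addDivFn P a).toNat : ℝ) ≤ c) : addRF P S r ≤ c := by
  refine csSup_le (Set.insert_nonempty _ _) ?_
  rintro x (rfl | ⟨a, ⟨ha, h0⟩, rfl⟩)
  exacts [hc, h a ha h0]

lemma finiteIndex_comap (f : A →+ B) {N : AddSubgroup B} (hN : N.FiniteIndex) :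
    (N.comap f).FiniteIndex := by
  refine ⟨?_⟩
  rw [AddSubgroup.index_comap]
  exact fun h => hN.index_ne_zero (AddSubgroup.index_eq_zero_of_relIndex_eq_zero h)

/-- Pulling back finite-index subgroups along `f` bounds the divisibility of `a` by that
of `f a`. -/
lemma addDivFn_le_of_comap {P : Set (AddSubgroup A)} {Q : Set (AddSubgroup B)} (f : A →+ B)
    (hQ : ∀ N ∈ Q, N.FiniteIndex) (hf : ∀ N ∈ Q, N.comap f ∈ P) (a : A) :
    addDivFn P a ≤ addDivFn Q (f a) := by
  refine le_sInf ?_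
  rintro _ ⟨N, hN, ha, rfl⟩
  have hle : addDivFn P a ≤ ((N.comap f).index : ℕ∞) := sInf_le ⟨N.comap f, hf N hN, ha, rfl⟩
  refine hle.trans ?_
  rw [AddSubgroup.index_comap]
  exact_mod_cast Nat.le_of_dvd (Nat.pos_of_ne_zero (hQ N hN).index_ne_zero)
    (AddSubgroup.relIndex_dvd_index_of_normal N f.range)

lemma addDivFn_toNat_le_addRF {P : Set (AddSubgroup A)} {Q : Set (AddSubgroup B)} (f : A →+ B)
    (hQ : ∀ N ∈ Q, N.FiniteIndex) (hf : ∀ N ∈ Q, N.comap f ∈ P)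
    (hsep : ∀ b : B, b ≠ 0 → addDivFn Q b ≠ ⊤) {T : Finset B} {a : A} {r : ℝ} (h0 : f a ≠ 0)
    (ha : f a ∈ addWordBall T r) : ((addDivFn P a).toNat : ℝ) ≤ addRF Q T r :=
  le_trans (by
    exact_mod_cast ENat.toNat_le_toNat (addDivFn_le_of_comap f hQ hf a) (hsep _ h0))
    (addDivFn_le_addRF Q ha h0)

end Divisibility

section Lattice

variable {m : ℕ}

lemma castHom_injective (m : ℕ) : Function.Injective (castHom m) := fun v w h => by
  funext i
  exact Int.cast_injective (α := ℚ) (congrFun h i)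

lemma ratAct_castHom (M : Matrix (Fin m) (Fin m) ℤ) (v : Fin m → ℤ) :
    ratAct M (castHom m v) = castHom m (intAct M v) := by
  funext i
  exact ((Int.castRingHom ℚ).map_mulVec M v i).symm

lemma ratAct_mul (M N : Matrix (Fin m) (Fin m) ℤ) (v : Fin m → ℚ) :
    ratAct (M * N) v = ratAct M (ratAct N v) := by
  have : (M * N).map (Int.cast : ℤ → ℚ) = M.map Int.cast * N.map Int.cast :=
    Matrix.map_mul (f := Int.castRingHom ℚ)
  simp [ratAct, this]

variable {H : Type*} [Group H] (φ : H →* Matrix.GeneralLinearGroup (Fin m) ℤ)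

lemma intAct_intAct_inv (h : H) (v : Fin m → ℤ) :
    intAct (φ h : Matrix (Fin m) (Fin m) ℤ) (intAct (φ h⁻¹ : Matrix (Fin m) (Fin m) ℤ) v) = v := by
  simp [intAct]

lemma ratAct_ratAct_inv (h : H) (v : Fin m → ℚ) :
    ratAct (φ h : Matrix (Fin m) (Fin m) ℤ) (ratAct (φ h⁻¹ : Matrix (Fin m) (Fin m) ℤ) v) = v := by
  rw [← ratAct_mul, ← Units.val_mul, ← map_mul]
  simp [ratAct]

lemma mem_InvSet_iff {N : AddSubgroup (Fin m → ℤ)} :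
    N ∈ InvSet φ ↔ N.FiniteIndex ∧
      ∀ h : H, ∀ v ∈ N, intAct (φ h : Matrix (Fin m) (Fin m) ℤ) v ∈ N := by
  refine and_congr_right fun _ => ⟨fun hN h v hv => ?_, fun hN h => le_antisymm ?_ fun v hv => ?_⟩
  · rw [← hN h]
    exact ⟨v, hv, rfl⟩
  · rintro _ ⟨v, hv, rfl⟩
    exact hN h v hv
  · exact ⟨_, hN h⁻¹ v hv, intAct_intAct_inv φ h v⟩

lemma mem_InvSub_iff {K : AddSubgroup (Fin m → ℚ)} {N : AddSubgroup K} :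
    N ∈ InvSub K φ ↔ N.FiniteIndex ∧ ∀ h : H, ∀ v ∈ N,
      ratAct (φ h : Matrix (Fin m) (Fin m) ℤ) (v : Fin m → ℚ) ∈ N.map K.subtype := by
  refine and_congr_right fun _ => ⟨fun hN h v hv => ?_, fun hN h => le_antisymm ?_ ?_⟩
  · rw [← hN h]
    exact ⟨v, ⟨v, hv, rfl⟩, rfl⟩
  · rintro _ ⟨_, ⟨v, hv, rfl⟩, rfl⟩
    exact hN h v hv
  · rintro _ ⟨v, hv, rfl⟩
    exact ⟨_, hN h⁻¹ v hv, ratAct_ratAct_inv φ h v⟩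

/-- The invariant finite-index subgroups `kℤ^m` separate the points of `ℤ^m`. -/
lemma addDivFn_InvSet_ne_top {v : Fin m → ℤ} (hv : v ≠ 0) : addDivFn (InvSet φ) v ≠ ⊤ := by
  obtain ⟨j, hj⟩ := Function.ne_iff.1 hv
  let k : ℕ := (v j).natAbs + 1
  let f : (Fin m → ℤ) →+ (Fin m → ZMod k) := (Int.castAddHom (ZMod k)).compLeft (Fin m)
  refine addDivFn_ne_top (N := f.ker) ((mem_InvSet_iff φ).2 ⟨inferInstance, ?_⟩) ?_
  · intro h w hw
    rw [AddMonoidHom.mem_ker] at hw ⊢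
    funext i
    have hw' : (Int.castRingHom (ZMod k)) ∘ w = 0 := hw
    have := (Int.castRingHom (ZMod k)).map_mulVec (φ h : Matrix (Fin m) (Fin m) ℤ) w i
    rw [hw', Matrix.mulVec_zero] at this
    exact this
  · intro hmem
    have h0 : ((v j : ℤ) : ZMod k) = 0 := congrFun ((AddMonoidHom.mem_ker).1 hmem) j
    rw [ZMod.intCast_zmod_eq_zero_iff_dvd] at h0
    have := Int.natAbs_dvd_natAbs.2 h0
    have := Nat.le_of_dvd (Int.natAbs_pos.2 hj) this
    rw [Int.natAbs_natCast] at this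
    lia

end Lattice

section Projection

variable {m : ℕ} {H : Type*} [Group H] (φ : H →* Matrix.GeneralLinearGroup (Fin m) ℤ)
  (p : (Fin m → ℚ) →ₗ[ℚ] (Fin m → ℚ))

/-- The homomorphism `ℤ^m → K_p` induced by a projection `p`. -/
def projHom : (Fin m → ℤ) →+ Ki p :=
  (p.toAddMonoidHom.comp (castHom m)).codRestrict (Ki p) fun v => ⟨_, ⟨v, rfl⟩, rfl⟩

lemma coe_projHom (v : Fin m → ℤ) : (projHom p v : Fin m → ℚ) = p (castHom m v) := rfl

variable {p}

/-- A multiple of `K_p` embeds in `ℤ^m`. -/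
lemma exists_scaleHom {T : Finset (Ki p)} (hT : AddSubgroup.closure (T : Set (Ki p)) = ⊤) :
    ∃ (d : ℤ) (g : Ki p →+ (Fin m → ℤ)), d ≠ 0 ∧
      ∀ x, castHom m (g x) = d • (x : Fin m → ℚ) := by
  obtain ⟨⟨d, hd⟩, hb⟩ := IsLocalization.exist_integer_multiples (nonZeroDivisors ℤ)
    (T ×ˢ (Finset.univ : Finset (Fin m))) (fun x => (x.1 : Fin m → ℚ) x.2)
  have hle : (⊤ : AddSubgroup (Ki p)) ≤
      (castHom m).range.comap ((zsmulAddGroupHom d).comp (Ki p).subtype) := by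
    rw [← hT, AddSubgroup.closure_le]
    intro x hx
    have : ∀ j, ∃ z : ℤ, (z : ℚ) = d • (x : Fin m → ℚ) j := fun j =>
      hb (x, j) (by simpa using hx)
    choose z hz using this
    exact ⟨z, funext hz⟩
  have hex : ∀ x : Ki p, ∃ z, castHom m z = d • (x : Fin m → ℚ) := fun x =>
    hle (AddSubgroup.mem_top x)
  choose g hg using hex
  refine ⟨d, AddMonoidHom.mk' g fun x y => castHom_injective m ?_, nonZeroDivisors.ne_zero hd, hg⟩
  rw [map_add, hg, hg, hg, AddSubgroup.coe_add, smul_add]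

lemma comap_projHom_mem_InvSet
    (hp : ∀ (h : H) (v : Fin m → ℚ), p (ratAct (φ h : Matrix (Fin m) (Fin m) ℤ) v) =
      ratAct (φ h : Matrix (Fin m) (Fin m) ℤ) (p v)) {N : AddSubgroup (Ki p)} (hN : N ∈ InvSub (Ki p) φ) :
    N.comap (projHom p) ∈ InvSet φ := by
  rw [mem_InvSub_iff] at hN
  rw [mem_InvSet_iff]
  refine ⟨finiteIndex_comap _ hN.1, fun h v hv => ?_⟩
  obtain ⟨x, hx, hxe⟩ := hN.2 h _ hv
  have : projHom p (intAct (φ h : Matrix (Fin m) (Fin m) ℤ) v) = x := by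
    apply Subtype.ext
    rw [coe_projHom, ← ratAct_castHom, hp]
    exact hxe.symm
  rw [AddSubgroup.mem_comap, this]
  exact hx

lemma comap_scaleHom_mem_InvSub
    (hp : ∀ (h : H) (v : Fin m → ℚ), p (ratAct (φ h : Matrix (Fin m) (Fin m) ℤ) v) =
      ratAct (φ h : Matrix (Fin m) (Fin m) ℤ) (p v)) {d : ℤ} {g : Ki p →+ (Fin m → ℤ)}
    (hg : ∀ x, castHom m (g x) = d • (x : Fin m → ℚ)) {N : AddSubgroup (Fin m → ℤ)}
    (hN : N ∈ InvSet φ) : N.comap g ∈ InvSub (Ki p) φ := by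
  rw [mem_InvSet_iff] at hN
  rw [mem_InvSub_iff]
  refine ⟨finiteIndex_comap _ hN.1, fun h x hx => ?_⟩
  obtain ⟨_, _, ⟨v, rfl⟩, rfl⟩ := x
  set x : Ki p := projHom p v
  change ratAct _ (x : Fin m → ℚ) ∈ _
  have hx' : g x ∈ N := hx
  let y : Ki p := projHom p (intAct (φ h : Matrix (Fin m) (Fin m) ℤ) v)
  have hy : (y : Fin m → ℚ) = ratAct (φ h : Matrix (Fin m) (Fin m) ℤ) (x : Fin m → ℚ) := by
    rw [coe_projHom, ← ratAct_castHom, hp, coe_projHom]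
  refine ⟨y, ?_, hy⟩
  have : g y = intAct (φ h : Matrix (Fin m) (Fin m) ℤ) (g x) := by
    apply castHom_injective
    rw [hg, hy, ← ratAct_castHom, hg, map_zsmul]
  change g y ∈ N
  rw [this]
  exact hN.2 h _ hx'

end Projection

/-- The projections of an invariant decomposition commute with the representation. -/
lemma projection_ratAct_comm {m n : ℕ} (M : Matrix (Fin m) (Fin m) ℤ)
    {W : Fin n → Submodule ℚ (Fin m → ℚ)} {π : Fin n → ((Fin m → ℚ) →ₗ[ℚ] (Fin m → ℚ))}
    (hrange : ∀ i, LinearMap.range (π i) = W i)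
    (hproj : ∀ i, ∀ w ∈ W i, π i w = w)
    (horth : ∀ i j : Fin n, i ≠ j → (π i).comp (π j) = 0)
    (hsum : ∑ i : Fin n, π i = LinearMap.id)
    (hinv : ∀ i, ∀ w ∈ W i, ratAct M w ∈ W i) (i : Fin n) (v : Fin m → ℚ) :
    π i (ratAct M v) = ratAct M (π i v) := by
  have hv : v = ∑ j, π j v := by
    rw [← LinearMap.sum_apply, hsum, LinearMap.id_apply]
  have hmem : ∀ j, ratAct M (π j v) ∈ W j := fun j =>
    hinv j _ (hrange j ▸ LinearMap.mem_range_self (π j) v)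
  conv_lhs => rw [hv, map_sum, map_sum]
  rw [Finset.sum_eq_single i _ (by simp), hproj i _ (hmem i)]
  intro j _ hj
  rw [← hproj j _ (hmem j)]
  exact LinearMap.congr_fun (horth i j hj.symm) _

/-- if `ℚ^m = W₁ ⊕ ⋯ ⊕ Wₙ` is a decomposition of the integral
representation `φ : H → GL(m,ℤ)` into irreducible `ℚ`-subrepresentations, with natural
projections `πᵢ` onto `Wᵢ` and `Kᵢ = πᵢ(ℤ^m)`, then
`RF_{ℤ^m, Inv(φ)} ≈ max_i RF_{Kᵢ, Inv(φᵢ)}` (for any choice of word metrics on the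
`Kᵢ`). -/
theorem stmt_10 {H : Type*} [Group H] [Fintype H] {m : ℕ}
    (φ : H →* Matrix.GeneralLinearGroup (Fin m) ℤ)
    (S : Finset (Fin m → ℤ)) (hS : AddSubgroup.closure (S : Set (Fin m → ℤ)) = ⊤)
    (n : ℕ) (hn : 0 < n)
    (W : Fin n → Submodule ℚ (Fin m → ℚ))
    (π : Fin n → ((Fin m → ℚ) →ₗ[ℚ] (Fin m → ℚ)))
    (hrange : ∀ i, LinearMap.range (π i) = W i)
    (hproj : ∀ i, ∀ w ∈ W i, π i w = w)
    (horth : ∀ i j : Fin n, i ≠ j → (π i).comp (π j) = 0)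
    (hsum : ∑ i : Fin n, π i = LinearMap.id)
    (hirr : ∀ i, IsIrredQ (fun h => (φ h : Matrix (Fin m) (Fin m) ℤ)) (W i))
    (T : ∀ i : Fin n, Finset (Ki (π i)))
    (hT : ∀ i, AddSubgroup.closure ((T i : Set (Ki (π i)))) = ⊤) :
    GrowthEquiv (addRF (InvSet φ) S)
      (fun r => ⨆ i : Fin n, addRF (InvSub (Ki (π i)) φ) (T i) r) := by
  have hcomm : ∀ i (h : H) (v : Fin m → ℚ),
      π i (ratAct (φ h : Matrix (Fin m) (Fin m) ℤ) v) =
        ratAct (φ h : Matrix (Fin m) (Fin m) ℤ) (π i v) := fun i h v =>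
    projection_ratAct_comm _ hrange hproj horth hsum (fun j => (hirr j).2.1 h) i v
  have : Nonempty (Fin n) := ⟨⟨0, hn⟩⟩
  have hle : ∀ i r, addRF (InvSub (Ki (π i)) φ) (T i) r ≤
      ⨆ i : Fin n, addRF (InvSub (Ki (π i)) φ) (T i) r := fun i r =>
    le_ciSup (f := fun i => addRF (InvSub (Ki (π i)) φ) (T i) r) (Set.finite_range _).bddAbove i
  have hone : ∀ r, 1 ≤ ⨆ i : Fin n, addRF (InvSub (Ki (π i)) φ) (T i) r := fun r =>
    (one_le_addRF _ _ _).trans (hle ⟨0, hn⟩ r)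
  choose d g hd hg using fun i => exists_scaleHom (hT i)
  have hg0 : ∀ i (x : Ki (π i)), x ≠ 0 → g i x ≠ 0 := by
    intro i x hx h0
    have h := hg i x
    rw [h0, map_zero, eq_comm, smul_eq_zero] at h
    exact hx (Subtype.ext (h.resolve_left (hd i)))
  have hgcomap : ∀ i, ∀ N ∈ InvSet φ, N.comap (g i) ∈ InvSub (Ki (π i)) φ := fun i N hN =>
    comap_scaleHom_mem_InvSub φ (hcomm i) (hg i) hN
  have hsep : ∀ i (x : Ki (π i)), x ≠ 0 → addDivFn (InvSub (Ki (π i)) φ) x ≠ ⊤ := fun i x hx =>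
    ne_top_of_le_ne_top (addDivFn_InvSet_ne_top φ (hg0 i x hx))
      (addDivFn_le_of_comap (g i) (fun N hN => hN.1) (hgcomap i) x)
  constructor
  · choose c hc1 hc using fun i => exists_map_mem_addWordBall (projHom (π i)) S (hT i)
    obtain ⟨C, hC⟩ := (Set.finite_range c).bddAbove
    have hcC : ∀ i, c i ≤ C := fun i => hC ⟨i, rfl⟩
    have hC1 : 1 ≤ C := (hc1 ⟨0, hn⟩).trans (hcC _)
    refine ⟨C, by linarith, fun r hr => ?_⟩
    have hr1 : 1 ≤ r := (le_max_left _ _).trans hr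
    refine le_trans ?_ (le_mul_of_one_le_left (zero_le_one.trans (hone (C * r))) hC1)
    refine addRF_le _ (hone _) fun a ha h0 => ?_
    obtain ⟨i, hi⟩ : ∃ i, projHom (π i) a ≠ 0 := by
      by_contra! hall
      refine h0 (castHom_injective m ?_)
      rw [map_zero, ← LinearMap.id_apply (R := ℚ) (castHom m a), ← hsum, LinearMap.sum_apply]
      exact Finset.sum_eq_zero fun i _ => congrArg Subtype.val (hall i)
    refine le_trans ?_ (hle i _)
    exact addDivFn_toNat_le_addRF (projHom (π i)) (fun N hN => hN.1)
      (fun N hN => comap_projHom_mem_InvSet φ (hcomm i) hN) (hsep i) hi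
      (addWordBall_mono _ (mul_le_mul_of_nonneg_right (hcC i) (by linarith)) (hc i r a ha))
  · choose c hc1 hc using fun i => exists_map_mem_addWordBall (g i) (T i) hS
    obtain ⟨C, hC⟩ := (Set.finite_range c).bddAbove
    have hcC : ∀ i, c i ≤ C := fun i => hC ⟨i, rfl⟩
    have hC1 : 1 ≤ C := (hc1 ⟨0, hn⟩).trans (hcC _)
    refine ⟨C, by linarith, fun r hr => ?_⟩
    have hr1 : 1 ≤ r := (le_max_left _ _).trans hr
    refine le_trans ?_ (le_mul_of_one_le_left (zero_le_one.trans (one_le_addRF _ S (C * r))) hC1)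
    refine ciSup_le fun i => addRF_le _ (one_le_addRF _ _ _) fun a ha h0 => ?_
    exact addDivFn_toNat_le_addRF (g i) (fun N hN => hN.1) (hgcomap i)
      (fun b hb => addDivFn_InvSet_ne_top φ hb) (hg0 i a h0)
      (addWordBall_mono _ (mul_le_mul_of_nonneg_right (hcC i) (by linarith)) (hc i r a ha))
end

section
/- Let φ : H → GL(m,ℤ) be an integral representation of a finite group H that is irreducible over ℚ, and let B ∈ ℤ^{m×m} with det B ≠ 0 commute with φ, i.e., φ(h)B = Bφ(h) for all h ∈ H. Let k be the dimension of the absolutely irreducible (ℂ-irreducible) subrepresentations of φ. Then there exists an integer x ∈ ℤ such that det B = x^k and x·ℤ^m ⊆ B(ℤ^m). -/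
/-- The image subgroup `B(ℤ^m) ⊆ ℤ^m` of an integer matrix `B`. -/
def matRange {m : ℕ} (B : Matrix (Fin m) (Fin m) ℤ) : AddSubgroup (Fin m → ℤ) :=
  (intAct B).range

/-- `Com(φ)`: the subgroups in `Inv(φ)` of the form `B(ℤ^m)` for an integer matrix
`B` with `det B ≠ 0` commuting with every `φ(h)`. -/
def ComSet {H : Type*} [Group H] {m : ℕ}
    (φ : H →* Matrix.GeneralLinearGroup (Fin m) ℤ) : Set (AddSubgroup (Fin m → ℤ)) :=
  {N | N ∈ InvSet φ ∧ ∃ B : Matrix (Fin m) (Fin m) ℤ, B.det ≠ 0 ∧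
    (∀ h : H, B * ((φ h : Matrix (Fin m) (Fin m) ℤ)) =
      ((φ h : Matrix (Fin m) (Fin m) ℤ)) * B) ∧
    N = matRange B}

open Polynomial in
/-- If every polynomial in `f` is zero or injective, the minimal polynomial of `f` is irreducible. -/
theorem Module.End.irreducible_minpoly_of_ker_aeval {K V : Type*} [Field K] [AddCommGroup V]
    [Module K V] [FiniteDimensional K V] [Nontrivial V] (f : Module.End K V)
    (hf : ∀ p : K[X], LinearMap.ker (aeval f p) = ⊥ ∨ LinearMap.ker (aeval f p) = ⊤) :
    Irreducible (minpoly K f) := by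
  have hne : minpoly K f ≠ 0 := minpoly.ne_zero_of_finite K f
  refine irreducible_iff_prime.mpr ⟨hne, minpoly.not_isUnit K f, fun p q hpq => ?_⟩
  rw [minpoly.dvd_iff, map_mul] at hpq
  simp only [minpoly.dvd_iff]
  refine (hf p).symm.imp LinearMap.ker_eq_top.mp fun hp => ?_
  exact LinearMap.cancel_left (LinearMap.ker_eq_bot.mp hp) |>.mp (by simpa using! hpq)

open Polynomial in
/-- A matrix with irreducible minimal polynomial has a power of it as characteristic polynomial. -/
theorem Matrix.exists_charpoly_eq_minpoly_pow {K n : Type*} [Field K] [Fintype n] [DecidableEq n]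
    (M : Matrix n n K) (hirr : Irreducible (minpoly K M)) :
    ∃ r : ℕ, M.charpoly = minpoly K M ^ r := by
  have hmon := minpoly.monic (Matrix.isIntegral M)
  obtain ⟨g, hg, hndvd⟩ :=
    (FiniteMultiplicity.of_not_isUnit hirr.not_isUnit
      M.charpoly_monic.ne_zero).exists_eq_pow_mul_and_not_dvd
  have hgmon : g.Monic := (hmon.pow _).of_mul_monic_left (hg ▸ M.charpoly_monic)
  suffices h : g = 1 from ⟨_, by rwa [h, mul_one] at hg⟩
  by_contra hne
  let L := AlgebraicClosure K
  obtain ⟨c, hc⟩ := IsAlgClosed.exists_aeval_eq_zero L g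
    (fun h => hne (hgmon.natDegree_eq_zero.mp (natDegree_eq_of_degree_eq_some h)))
  have hroot : (M.map (algebraMap K L)).charpoly.IsRoot c := by
    rw [Matrix.charpoly_map, IsRoot, eval_map_algebraMap, hg, map_mul, hc, mul_zero]
  rw [← Matrix.charpoly_toLin', ← Module.End.hasEigenvalue_iff_isRoot_charpoly] at hroot
  have hmin := Module.End.isRoot_of_hasEigenvalue hroot
  rw [Matrix.minpoly_toLin'] at hmin
  have hdvd : minpoly L (M.map (algebraMap K L)) ∣ (minpoly K M).map (algebraMap K L) := by
    rw [minpoly.dvd_iff, aeval_map_algebraMap]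
    exact minpoly.aeval_algHom K (Algebra.ofId K L).mapMatrix M
  have hcM := hmin.dvd hdvd
  rw [IsRoot, eval_map_algebraMap] at hcM
  exact hndvd ((hirr.dvd_iff_aeval_eq_zero hcM).mp hc)

/-- If all irreducible subrepresentations of a semisimple representation have dimension `k`, then
`k` divides the dimension of every subrepresentation. -/
theorem Subrepresentation.dvd_finrank_of_isAtom {K G V : Type*} [Field K] [Group G]
    [AddCommGroup V] [Module K V] [FiniteDimensional K V] (ρ : Representation K G V)
    [ρ.IsSemisimpleRepresentation] (k : ℕ)
    (hk : ∀ A : Subrepresentation ρ, IsAtom A → Module.finrank K A.toSubmodule = k)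
    (W : Subrepresentation ρ) : k ∣ Module.finrank K W.toSubmodule := by
  have hmono : StrictMono (Subrepresentation.toSubmodule : Subrepresentation ρ → Submodule K V) :=
    Monotone.strictMono_of_injective (fun _ _ h => h) Subrepresentation.toSubmodule_injective
  have : WellFoundedLT (Subrepresentation ρ) := hmono.wellFoundedLT
  have : IsAtomic (Subrepresentation ρ) := isAtomic_of_orderBot_wellFounded_lt wellFounded_lt
  induction W using WellFoundedLT.induction with
  | ind W ih =>
    obtain rfl | ⟨A, hA, hAW⟩ := eq_bot_or_exists_atom_le W
    · have : (⊥ : Subrepresentation ρ).toSubmodule = ⊥ := rfl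
      rw [this, finrank_bot]
      exact dvd_zero k
    obtain ⟨C, hC⟩ := exists_isCompl A
    have hdisj : A.toSubmodule ⊓ (C ⊓ W).toSubmodule = ⊥ := by
      have : A ⊓ (C ⊓ W) = ⊥ := by rw [← inf_assoc, hC.inf_eq_bot, bot_inf_eq]
      exact congrArg Subrepresentation.toSubmodule this
    have hsup : A.toSubmodule ⊔ (C ⊓ W).toSubmodule = W.toSubmodule := by
      have htop : A.toSubmodule ⊔ C.toSubmodule = ⊤ :=
        congrArg Subrepresentation.toSubmodule hC.sup_eq_top
      have hle : A.toSubmodule ≤ W.toSubmodule := hAW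
      rw [Subrepresentation.toSubmodule_inf, ← sup_inf_assoc_of_le _ hle, htop, top_inf_eq]
    have hlt : C ⊓ W < W := by
      refine inf_le_right.lt_of_ne fun h => hA.1 ?_
      exact hC.disjoint.eq_bot_of_le (hAW.trans (inf_eq_right.mp h))
    have hdim := Submodule.finrank_sup_add_finrank_inf_eq A.toSubmodule (C ⊓ W).toSubmodule
    rw [hdisj, hsup, finrank_bot, add_zero, hk A hA] at hdim
    rw [hdim]
    exact dvd_add dvd_rfl (ih _ hlt)

open Polynomial in
/-- If the characteristic polynomial of `B` is `P ^ k` with `P` monic and `P(B) = 0`, then `det B`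
is a `k`-th power `x ^ k` with `x Rⁿ ⊆ B(Rⁿ)`; up to sign, `x` is the constant term of `P`. -/
theorem Matrix.exists_det_eq_pow_of_charpoly_eq_pow {R n : Type*} [CommRing R] [Nontrivial R]
    [Fintype n] [DecidableEq n] (B : Matrix n n R) (P : R[X]) (hP : P.Monic) (k : ℕ)
    (hchar : B.charpoly = P ^ k) (hB : aeval B P = 0) :
    ∃ x : R, B.det = x ^ k ∧ ∀ v : n → R, ∃ u : n → R, B.mulVec u = x • v := by
  refine ⟨(-1) ^ P.natDegree * P.coeff 0, ?_, fun v => ?_⟩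
  · have hdeg : Fintype.card n = P.natDegree * k := by
      rw [← B.charpoly_natDegree_eq_dim, hchar, hP.natDegree_pow, mul_comm]
    rw [Matrix.det_eq_sign_charpoly_coeff, hchar, hdeg, mul_pow, ← pow_mul,
      coeff_zero_eq_eval_zero, coeff_zero_eq_eval_zero, eval_pow]
  · have hmul : B * aeval B P.divX = -(P.coeff 0 • (1 : Matrix n n R)) := by
      rw [← X_mul_divX_add P] at hB
      rwa [map_add, map_mul, aeval_X, aeval_C, Algebra.algebraMap_eq_smul_one,
        ← eq_neg_iff_add_eq_zero] at hB
    refine ⟨(-(-1) ^ P.natDegree : R) • (aeval B P.divX).mulVec v, ?_⟩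
    rw [Matrix.mulVec_smul, Matrix.mulVec_mulVec, hmul, Matrix.neg_mulVec, Matrix.smul_mulVec,
      Matrix.one_mulVec, smul_neg, neg_smul, neg_neg, smul_smul]

open Polynomial in
/-- An integer matrix commuting with a `ℚ`-irreducible family of integer matrices has an irreducible
minimal polynomial over `ℚ`. -/
theorem irreducible_minpoly_of_commute {H : Type*} {m : ℕ} [NeZero m]
    (ρ : H → Matrix (Fin m) (Fin m) ℤ)
    (hQirr : ∀ W : Submodule ℚ (Fin m → ℚ), InvariantQ ρ W → W = ⊥ ∨ W = ⊤)
    (B : Matrix (Fin m) (Fin m) ℤ) (hcomm : ∀ h, Commute B (ρ h)) :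
    Irreducible (minpoly ℚ (B.map (Int.cast : ℤ → ℚ))) := by
  rw [← Matrix.minpoly_toLin']
  refine Module.End.irreducible_minpoly_of_ker_aeval _ fun p => hQirr _ fun h v hv => ?_
  have hc : Commute (Matrix.toLin' (B.map (Int.cast : ℤ → ℚ)))
      (Matrix.toLin' ((ρ h).map (Int.cast : ℤ → ℚ))) :=
    ((hcomm h).map (Int.castRingHom ℚ).mapMatrix).map Matrix.toLinAlgEquiv'
  have hp := DFunLike.congr_fun (Algebra.commute_of_mem_adjoin_singleton_of_commute
    (aeval_mem_adjoin_singleton ℚ _ (p := p)) hc.symm).eq v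
  rw [Module.End.mul_apply, Module.End.mul_apply, LinearMap.mem_ker.mp hv, map_zero] at hp
  exact hp.symm

/-- The complex representation given by a group of integer matrices. -/
noncomputable def complexRep {H : Type*} [Group H] {m : ℕ}
    (φ : H →* Matrix.GeneralLinearGroup (Fin m) ℤ) : Representation ℂ H (Fin m → ℂ) :=
  (Matrix.toLinAlgEquiv' (R := ℂ) (n := Fin m)).toMulEquiv.toMonoidHom.comp
    ((Int.castRingHom ℂ).mapMatrix.toMonoidHom.comp ((Units.coeHom _).comp φ))

/-- If all irreducible complex subrepresentations have dimension `k`, then `k` divides the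
multiplicity of every root of the characteristic polynomial of a matrix in the commutant. -/
theorem dvd_rootMultiplicity_charpoly_of_commute {H : Type*} [Group H] [Finite H] {m : ℕ}
    (φ : H →* Matrix.GeneralLinearGroup (Fin m) ℤ) (k : ℕ)
    (hk : ∀ W : Submodule ℂ (Fin m → ℂ),
      IsIrredC (fun h => (φ h : Matrix (Fin m) (Fin m) ℤ)) W → Module.finrank ℂ W = k)
    (B : Matrix (Fin m) (Fin m) ℤ) (hcomm : ∀ h, Commute B (φ h : Matrix (Fin m) (Fin m) ℤ))
    (c : ℂ) : k ∣ (B.charpoly.map (Int.castRingHom ℂ)).rootMultiplicity c := by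
  have hc (h : H) : Commute (Matrix.toLin' (B.map (Int.cast : ℤ → ℂ))) (complexRep φ h) :=
    ((hcomm h).map (Int.castRingHom ℂ).mapMatrix).map Matrix.toLinAlgEquiv'
  rw [← Matrix.charpoly_map, ← Matrix.charpoly_toLin', ← LinearMap.finrank_maxGenEigenspace_eq]
  refine Subrepresentation.dvd_finrank_of_isAtom (complexRep φ) k (fun A hA => hk _ ?_)
    ⟨_, fun h => Module.End.mapsTo_maxGenEigenspace_of_comm (hc h) c⟩
  refine ⟨fun h => hA.1 (Subrepresentation.toSubmodule_injective h),
    A.apply_mem_toSubmodule, fun W' hle hne hinv => ?_⟩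
  let A' : Subrepresentation (complexRep φ) := ⟨W', hinv⟩
  have hA' : A' ≠ ⊥ := fun h => hne (congrArg Subrepresentation.toSubmodule h)
  exact congrArg Subrepresentation.toSubmodule ((hA.le_iff_eq hA').mp hle)

open Polynomial in
/-- if `φ : H → GL(m,ℤ)` is `ℚ`-irreducible with `ℂ`-irreducible
subrepresentations of dimension `k`, and the integer matrix `B` with `det B ≠ 0`
commutes with `φ`, then `det B = x^k` for some integer `x`, and `x·ℤ^m ⊆ B(ℤ^m)`. -/
theorem stmt_14 {H : Type*} [Group H] [Fintype H] {m : ℕ}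
    (φ : H →* Matrix.GeneralLinearGroup (Fin m) ℤ)
    (hQirr : ∀ W : Submodule ℚ (Fin m → ℚ),
      InvariantQ (fun h => (φ h : Matrix (Fin m) (Fin m) ℤ)) W → W = ⊥ ∨ W = ⊤)
    (k : ℕ)
    (hk : ∀ W : Submodule ℂ (Fin m → ℂ),
      IsIrredC (fun h => (φ h : Matrix (Fin m) (Fin m) ℤ)) W → Module.finrank ℂ W = k)
    (B : Matrix (Fin m) (Fin m) ℤ) (hdet : B.det ≠ 0)
    (hcomm : ∀ h : H, B * ((φ h : Matrix (Fin m) (Fin m) ℤ)) =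
      ((φ h : Matrix (Fin m) (Fin m) ℤ)) * B) :
    ∃ x : ℤ, B.det = x ^ k ∧ ∀ v : Fin m → ℤ, ∃ u : Fin m → ℤ, B.mulVec u = x • v := by
  rcases Nat.eq_zero_or_pos m with rfl | hm
  · exact ⟨1, by simp, fun v => ⟨v, funext fun i => i.elim0⟩⟩
  have : NeZero m := ⟨hm.ne'⟩
  obtain ⟨M, hM⟩ : ∃ M : Matrix (Fin m) (Fin m) ℚ, M = B.map (Int.cast : ℤ → ℚ) := ⟨_, rfl⟩
  have hirr : Irreducible (minpoly ℚ M) := by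
    rw [hM]
    exact irreducible_minpoly_of_commute (fun h => (φ h : Matrix (Fin m) (Fin m) ℤ)) hQirr B hcomm
  have hmon : (minpoly ℚ M).Monic := minpoly.monic M.isIntegral
  obtain ⟨r, hr⟩ := M.exists_charpoly_eq_minpoly_pow hirr
  have hcharM : M.charpoly = B.charpoly.map (algebraMap ℤ ℚ) := by
    rw [hM]
    exact Matrix.charpoly_map B (algebraMap ℤ ℚ)
  obtain ⟨p, hp⟩ : ∃ p : ℤ[X], p.map (algebraMap ℤ ℚ) = minpoly ℚ M := by
    obtain ⟨p, hp⟩ := IsIntegrallyClosed.eq_map_mul_C_of_dvd ℚ B.charpoly_monic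
      (hcharM ▸ M.minpoly_dvd_charpoly)
    exact ⟨p, by simpa [hmon.leadingCoeff] using hp⟩
  have hinj : Function.Injective (algebraMap ℤ ℚ) := Int.cast_injective
  have hpmon : p.Monic := monic_of_injective hinj (hp ▸ hmon)
  have hchar : B.charpoly = p ^ r := by
    apply map_injective _ hinj
    rw [← hcharM, hr, Polynomial.map_pow, hp]
  have hpB : aeval B p = 0 := by
    have h : aeval M p = 0 := by rw [← aeval_map_algebraMap ℚ, hp, minpoly.aeval]
    have hmap : aeval M p = (aeval B p).map (Int.cast : ℤ → ℚ) := by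
      rw [hM]
      exact aeval_algHom_apply (Algebra.ofId ℤ ℚ).mapMatrix B p
    exact Matrix.map_injective Int.cast_injective
      ((hmap.symm.trans h).trans (Matrix.map_zero _ Int.cast_zero).symm)
  have hdvd : k ∣ r := by
    obtain ⟨c, hc⟩ := IsAlgClosed.exists_aeval_eq_zero ℂ (minpoly ℚ M)
      (minpoly.degree_pos M.isIntegral).ne'
    have hmapC : p.map (Int.castRingHom ℂ) = (minpoly ℚ M).map (algebraMap ℚ ℂ) := by
      rw [← hp, Polynomial.map_map]; congr 1
    have hne : (minpoly ℚ M).map (algebraMap ℚ ℂ) ≠ 0 := (hmon.map _).ne_zero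
    have hone : ((minpoly ℚ M).map (algebraMap ℚ ℂ)).rootMultiplicity c = 1 := by
      refine le_antisymm (rootMultiplicity_le_one_of_separable hirr.separable.map c) ?_
      rw [Nat.one_le_iff_ne_zero, ← Nat.pos_iff_ne_zero, rootMultiplicity_pos hne, IsRoot,
        eval_map_algebraMap, hc]
    have := dvd_rootMultiplicity_charpoly_of_commute φ k hk B hcomm c
    rwa [hchar, Polynomial.map_pow, hmapC, ← count_roots, roots_pow, Multiset.count_nsmul,
      count_roots, hone, mul_one] at this
  obtain ⟨t, rfl⟩ := hdvd
  have ht : t ≠ 0 := by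
    rintro rfl
    have := B.charpoly_natDegree_eq_dim
    simp [hchar, hm.ne] at this
  exact B.exists_det_eq_pow_of_charpoly_eq_pow (p ^ t) (hpmon.pow t) k
    (by rw [hchar, ← pow_mul, mul_comm]) (by rw [map_pow, hpB, zero_pow ht])
end

section
/- Let φ : H → GL(m,ℤ) be an integral representation of a finite group H. Then there exists a constant M > 0 such that for every B ∈ ℤ^{m×m} with det B ≠ 0 for which B(ℤ^m) ∈ Inv(φ), there exists B' ∈ ℤ^{m×m} commuting with φ(h) for all h ∈ H, such that B'(ℤ^m) ⊆ B(ℤ^m) and 0 < |det B'| ≤ M·|det B|. -/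
open Module

/-- Pigeonhole form of Minkowski's theorem for a finite-index subgroup of a lattice. -/
theorem exists_ne_zero_mem_abs_repr_le {L ι : Type*} [AddCommGroup L] [Fintype ι]
    (b : Basis ι ℤ L) (N : AddSubgroup L) [N.FiniteIndex] {k : ℕ}
    (hk : N.index < (k + 1) ^ Fintype.card ι) :
    ∃ w ∈ N, w ≠ 0 ∧ ∀ i, |b.repr w i| ≤ k := by
  classical
  have : Fintype (L ⧸ N) := Fintype.ofFinite _
  let v : (ι → Fin (k + 1)) → L := fun x ↦ b.equivFun.symm fun i ↦ ((x i : ℕ) : ℤ)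
  obtain ⟨x, y, hxy, h⟩ := Fintype.exists_ne_map_eq_of_card_lt
    (fun x ↦ (v x : L ⧸ N)) (by
      rw [Fintype.card_fun, Fintype.card_fin, ← Nat.card_eq_fintype_card]
      exact hk)
  refine ⟨-v x + v y, QuotientAddGroup.eq.mp h, fun h0 ↦ hxy ?_, fun i ↦ ?_⟩
  · have hv := b.equivFun.symm.injective (neg_add_eq_zero.mp h0)
    ext i
    exact_mod_cast congrFun hv i
  · have hr : b.repr (-v x + v y) i = -((x i : ℕ) : ℤ) + ((y i : ℕ) : ℤ) := by
      rw [← b.equivFun_apply, map_add, map_neg, b.equivFun.apply_symm_apply,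
        b.equivFun.apply_symm_apply]
      rfl
    rw [hr, abs_le]
    have := (x i).is_lt
    have := (y i).is_lt
    omega

theorem index_range_eq_natAbs_det {L : Type*} [AddCommGroup L] [Module.Finite ℤ L]
    [Module.Free ℤ L] (T : L →ₗ[ℤ] L) (hT : Function.Injective T) :
    T.toAddMonoidHom.range.index = (LinearMap.det T).natAbs :=
  (Submodule.natAbs_det_equiv T.range (LinearEquiv.ofInjective T hT)).symm

section

variable {H : Type*} [Group H]
variable {L : Type} [AddCommGroup L] [Module (MonoidAlgebra ℤ H) L]

theorem finite_submodule [Module.Finite ℤ L] (N : Submodule (MonoidAlgebra ℤ H) L) :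
    Module.Finite ℤ N :=
  inferInstanceAs (Module.Finite ℤ (N.restrictScalars ℤ))

theorem free_submodule [Module.Finite ℤ L] [Module.Free ℤ L]
    (N : Submodule (MonoidAlgebra ℤ H) L) : Module.Free ℤ N :=
  inferInstanceAs (Module.Free ℤ (N.restrictScalars ℤ))

theorem finiteIndex_of_smul_mem [Module.Finite ℤ L] (N : AddSubgroup L) {c : ℕ} (hc : c ≠ 0)
    (h : ∀ x, c • x ∈ N) : N.FiniteIndex := by
  have : Finite (L ⧸ N.toIntSubmodule) := by
    apply Module.finite_of_fg_torsion
    intro x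
    obtain ⟨x, rfl⟩ := Submodule.Quotient.mk_surjective _ x
    refine ⟨⟨(c : ℤ), by simpa using hc⟩, ?_⟩
    change (c : ℤ) • (Submodule.Quotient.mk x : L ⧸ N.toIntSubmodule) = 0
    rw [← Submodule.Quotient.mk_smul, Submodule.Quotient.mk_eq_zero]
    rw [natCast_zsmul]
    exact h x
  have : Finite (L ⧸ N) := this
  exact AddSubgroup.finiteIndex_of_finite_quotient

variable [Fintype H]

/-- The sum of the conjugates of the rank-one map `x ↦ f x • w`. -/
noncomputable abbrev rankOneAverage (f : L →ₗ[ℤ] ℤ) (w : L) : L →ₗ[MonoidAlgebra ℤ H] L :=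
  (f.smulRight w).sumOfConjugatesEquivariant H

theorem rankOneAverage_apply (f : L →ₗ[ℤ] ℤ) (w x : L) :
    rankOneAverage (H := H) f w x = ∑ h : H,
      f (MonoidAlgebra.single h (1 : ℤ) • x) • MonoidAlgebra.single h⁻¹ (1 : ℤ) • w := by
  rw [LinearMap.sumOfConjugatesEquivariant_apply]
  refine Finset.sum_congr rfl fun h _ ↦ ?_
  rw [LinearMap.conjugate_apply, LinearMap.smulRight_apply, smul_comm]

theorem rankOneAverage_ne_zero [Module.Finite ℤ L] [Module.Free ℤ L] (f : L →ₗ[ℤ] ℤ) (w : L)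
    (hw : f w ≠ 0) : rankOneAverage (H := H) f w ≠ 0 := by
  intro h0
  have h1 : (f.smulRight w).sumOfConjugates H = 0 := by
    ext x
    exact congrArg (fun T : L →ₗ[MonoidAlgebra ℤ H] L ↦ T x) h0
  have h2 := congrArg (LinearMap.trace ℤ L) h1
  have hconj (g : H) : LinearMap.trace ℤ L ((f.smulRight w).conjugate g) = f w := by
    rw [LinearMap.conjugate, LinearMap.trace_comp_comm', LinearMap.comp_assoc,
      ← LinearMap.trace_smulRight f w]
    congr 1
    ext x
    simp [MonoidAlgebra.GroupSMul.linearMap_apply, smul_smul, ← MonoidAlgebra.one_def,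
      MonoidAlgebra.single_mul_single]
  rw [LinearMap.sumOfConjugates, map_sum, Finset.sum_congr rfl fun g _ ↦ hconj g] at h2
  simp [hw] at h2

theorem exists_natAbs_det_rankOneAverage_le [Module.Finite ℤ L] [Module.Free ℤ L] {ι : Type*}
    [Fintype ι] (b : Basis ι ℤ L) :
    ∃ C : ℕ, ∀ (i : ι) (w : L) (k : ℕ), (∀ j, |b.repr w j| ≤ k) →
      (LinearMap.det ((rankOneAverage (H := H) (b.coord i) w).restrictScalars ℤ)).natAbs ≤
        C * k ^ Fintype.card ι := by
  classical
  let a (i j p q : ι) : ℤ := b.repr (rankOneAverage (H := H) (b.coord i) (b j) (b q)) p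
  let K : ℤ := ∑ i, ∑ j, ∑ p, ∑ q, |a i j p q|
  have hK (i p q : ι) : ∑ j, |a i j p q| ≤ K := by
    calc ∑ j, |a i j p q|
        ≤ ∑ j, ∑ p, ∑ q, |a i j p q| := by
          refine Finset.sum_le_sum fun j _ ↦ ?_
          refine (Finset.single_le_sum (f := fun q ↦ |a i j p q|) (fun _ _ ↦ abs_nonneg _)
            (Finset.mem_univ q)).trans ?_
          exact Finset.single_le_sum (f := fun p ↦ ∑ q, |a i j p q|)
            (fun _ _ ↦ Finset.sum_nonneg fun _ _ ↦ abs_nonneg _) (Finset.mem_univ p)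
      _ ≤ K := Finset.single_le_sum (f := fun i ↦ ∑ j, ∑ p, ∑ q, |a i j p q|)
            (fun _ _ ↦ by positivity) (Finset.mem_univ i)
  refine ⟨(Fintype.card ι).factorial * K.natAbs ^ Fintype.card ι, fun i w k hw ↦ ?_⟩
  have hK0 : 0 ≤ K := by positivity
  have hexp (x : L) : rankOneAverage (H := H) (b.coord i) w x =
      ∑ j, b.repr w j • rankOneAverage (H := H) (b.coord i) (b j) x := by
    simp only [rankOneAverage_apply]
    conv_lhs => rw [← b.sum_repr w]
    simp only [Finset.smul_sum]
    rw [Finset.sum_comm]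
    refine Finset.sum_congr rfl fun j _ ↦ Finset.sum_congr rfl fun h _ ↦ ?_
    rw [smul_comm _ (b.repr w j), smul_comm _ (b.repr w j)]
  have hent (p q : ι) : AbsoluteValue.abs (LinearMap.toMatrix b b
      ((rankOneAverage (H := H) (b.coord i) w).restrictScalars ℤ) p q) ≤ K * k := by
    rw [LinearMap.toMatrix_apply, AbsoluteValue.abs_apply, LinearMap.restrictScalars_apply, hexp]
    simp only [map_sum, map_smul, Finsupp.coe_finsetSum, Finset.sum_apply, Finsupp.smul_apply,
      smul_eq_mul]
    calc |∑ j, b.repr w j * a i j p q|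
        ≤ ∑ j, |b.repr w j * a i j p q| := Finset.abs_sum_le_sum_abs _ _
      _ ≤ ∑ j, k * |a i j p q| := by
          refine Finset.sum_le_sum fun j _ ↦ ?_
          rw [abs_mul]
          exact mul_le_mul_of_nonneg_right (hw j) (abs_nonneg _)
      _ ≤ K * k := by
          rw [← Finset.mul_sum, mul_comm]
          exact mul_le_mul_of_nonneg_right (hK i p q) (by positivity)
  have hdet := Matrix.det_le hent
  rw [LinearMap.det_toMatrix, AbsoluteValue.abs_apply, mul_pow, nsmul_eq_mul, ← mul_assoc] at hdet
  zify
  rwa [abs_of_nonneg hK0]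

/-- The bound for lattices all of whose nonzero equivariant endomorphisms are injective: average
a rank-one map onto a short vector of `N`; its trace shows that the average is nonzero. -/
theorem exists_bound_of_forall_injective [Module.Finite ℤ L] [Module.Free ℤ L]
    (hL : ∀ S : L →ₗ[MonoidAlgebra ℤ H] L, S ≠ 0 → Function.Injective S) :
    ∃ M : ℕ, M ≠ 0 ∧ ∀ N : Submodule (MonoidAlgebra ℤ H) L,
      (∃ c : ℕ, c ≠ 0 ∧ ∀ x : L, c • x ∈ N) →
      ∃ T : L →ₗ[MonoidAlgebra ℤ H] L, (∀ x, T x ∈ N) ∧ ∀ y ∈ N, ∃ x, T x = M • y := by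
  let b := Module.Free.chooseBasis ℤ L
  obtain ⟨C, hC⟩ := exists_natAbs_det_rankOneAverage_le (H := H) b
  refine ⟨C.factorial, C.factorial_ne_zero, fun N ⟨c, hc, hcN⟩ ↦ ?_⟩
  rcases isEmpty_or_nonempty (Module.Free.ChooseBasisIndex ℤ L) with hι | hι
  · have : Subsingleton L := b.repr.toEquiv.subsingleton
    exact ⟨0, fun x ↦ by simp, fun y _ ↦ ⟨0, Subsingleton.elim _ _⟩⟩
  have hfin : N.toAddSubgroup.FiniteIndex := finiteIndex_of_smul_mem _ hc hcN
  have hcard : Fintype.card (Module.Free.ChooseBasisIndex ℤ L) ≠ 0 := Fintype.card_ne_zero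
  set k := Nat.nthRoot (Fintype.card (Module.Free.ChooseBasisIndex ℤ L)) N.toAddSubgroup.index
  have hk : k ^ Fintype.card (Module.Free.ChooseBasisIndex ℤ L) ≤ N.toAddSubgroup.index :=
    Nat.pow_nthRoot_le (Or.inl hcard)
  obtain ⟨w, hwN, hw0, hwk⟩ := exists_ne_zero_mem_abs_repr_le b N.toAddSubgroup
    (Nat.lt_pow_nthRoot_add_one hcard _)
  obtain ⟨i, hi⟩ : ∃ i, b.coord i w ≠ 0 := by
    by_contra! h
    exact hw0 (b.forall_coord_eq_zero_iff.mp h)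
  let T := rankOneAverage (H := H) (b.coord i) w
  have hTinj : Function.Injective T := hL T (rankOneAverage_ne_zero _ _ hi)
  have hTN (x : L) : T x ∈ N := by
    rw [rankOneAverage_apply]
    exact N.sum_mem fun h _ ↦ N.toAddSubgroup.zsmul_mem (N.smul_mem _ hwN) _
  refine ⟨T, hTN, fun y hy ↦ ?_⟩
  let R := (T.restrictScalars ℤ).toAddMonoidHom.range
  have hRN : R ≤ N.toAddSubgroup := by
    rintro _ ⟨x, rfl⟩
    exact hTN x
  have hindex : R.index = (LinearMap.det (T.restrictScalars ℤ)).natAbs :=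
    index_range_eq_natAbs_det _ hTinj
  have hdet : LinearMap.det (T.restrictScalars ℤ) ≠ 0 := by
    rw [Ne, LinearMap.det_eq_zero_iff_ker_ne_bot, not_not]
    exact LinearMap.ker_eq_bot.mpr hTinj
  have hmul := AddSubgroup.relIndex_mul_index hRN
  have hrel0 : R.relIndex N.toAddSubgroup ≠ 0 := by
    intro h
    rw [h, zero_mul, hindex] at hmul
    exact hdet (Int.natAbs_eq_zero.mp hmul.symm)
  have hrel : R.relIndex N.toAddSubgroup ≤ C := by
    refine Nat.le_of_mul_le_mul_right ?_ (Nat.pos_of_ne_zero hfin.index_ne_zero)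
    rw [hmul, hindex]
    exact (hC i w k hwk).trans (Nat.mul_le_mul_left _ hk)
  obtain ⟨d, hd⟩ := Nat.dvd_factorial (Nat.pos_of_ne_zero hrel0) hrel
  have hmem : C.factorial • y ∈ R := by
    rw [hd, mul_comm, mul_smul]
    exact R.nsmul_mem (AddSubgroup.nsmul_relIndex_mem R hy) d
  exact hmem

theorem exists_equivariant_section {X Y : Type*} [AddCommGroup X] [AddCommGroup Y]
    [Module (MonoidAlgebra ℤ H) X] [Module (MonoidAlgebra ℤ H) Y] [Module.Free ℤ Y]
    (p : X →ₗ[MonoidAlgebra ℤ H] Y) (hp : Function.Surjective p) :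
    ∃ s : Y →ₗ[MonoidAlgebra ℤ H] X, ∀ y, p (s y) = Fintype.card H • y := by
  obtain ⟨s, hs⟩ := Module.projective_lifting_property (p.restrictScalars ℤ) LinearMap.id hp
  refine ⟨s.sumOfConjugatesEquivariant H, fun y ↦ ?_⟩
  have hs' (y : Y) : p (s y) = y := LinearMap.congr_fun hs y
  rw [LinearMap.sumOfConjugatesEquivariant_apply, map_sum]
  simp only [LinearMap.conjugate_apply, map_smul, hs', smul_smul,
    MonoidAlgebra.single_mul_single, inv_mul_cancel, mul_one, ← MonoidAlgebra.one_def, one_smul,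
    Finset.sum_const, Finset.card_univ]

/-- Every finite-index sublattice `N` of an `H`-lattice `L` contains an equivariant image `T(L)`
with `M • N ⊆ T(L)`, where `M` depends only on `L`. If some nonzero equivariant endomorphism `S`
is not injective, the bounds for `ker S` and `range S` are combined by averaged sections. -/
theorem exists_bound_of_finrank_le (n : ℕ) : ∀ (L : Type) [AddCommGroup L]
    [Module (MonoidAlgebra ℤ H) L] [Module.Finite ℤ L] [Module.Free ℤ L], finrank ℤ L ≤ n →
    ∃ M : ℕ, M ≠ 0 ∧ ∀ N : Submodule (MonoidAlgebra ℤ H) L,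
      (∃ c : ℕ, c ≠ 0 ∧ ∀ x : L, c • x ∈ N) →
      ∃ T : L →ₗ[MonoidAlgebra ℤ H] L, (∀ x, T x ∈ N) ∧ ∀ y ∈ N, ∃ x, T x = M • y := by
  induction n with
  | zero =>
    intro L _ _ _ _ hL
    have : Subsingleton L := finrank_zero_iff.mp (Nat.le_zero.mp hL)
    exact ⟨1, one_ne_zero, fun N _ ↦ ⟨0, fun x ↦ by simp, fun y _ ↦ ⟨0, Subsingleton.elim _ _⟩⟩⟩
  | succ n ih =>
    intro L _ _ _ _ hL
    by_cases hirr : ∀ S : L →ₗ[MonoidAlgebra ℤ H] L, S ≠ 0 → Function.Injective S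
    · exact exists_bound_of_forall_injective hirr
    push Not at hirr
    obtain ⟨S, hS0, hSinj⟩ := hirr
    have := finite_submodule S.ker
    have := finite_submodule S.range
    have := free_submodule S.ker
    have := free_submodule S.range
    have hrank : finrank ℤ S.range + finrank ℤ S.ker = finrank ℤ L := by
      have h := (S.restrictScalars ℤ).ker.finrank_quotient_add_finrank
      rw [(S.restrictScalars ℤ).quotKerEquivRange.finrank_eq] at h
      exact h
    have hker : finrank ℤ S.ker ≠ 0 := by
      rw [Ne, finrank_zero_iff, Submodule.subsingleton_iff_eq_bot, LinearMap.ker_eq_bot]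
      exact hSinj
    have hrange : finrank ℤ S.range ≠ 0 := by
      rw [Ne, finrank_zero_iff, Submodule.subsingleton_iff_eq_bot, LinearMap.range_eq_bot]
      exact hS0
    obtain ⟨M₁, hM₁, h₁⟩ := ih S.ker (by omega)
    obtain ⟨M₂, hM₂, h₂⟩ := ih S.range (by omega)
    obtain ⟨s, hs⟩ := exists_equivariant_section S.rangeRestrict S.surjective_rangeRestrict
    have hcard : Fintype.card H ≠ 0 := Fintype.card_ne_zero
    refine ⟨Fintype.card H * M₁ * (Fintype.card H * M₂), by positivity, fun N ⟨c, hc, hcN⟩ ↦ ?_⟩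
    obtain ⟨T₁, hT₁, hM₁T₁⟩ := h₁ (N.comap S.ker.subtype) ⟨c, hc, fun x ↦ hcN x⟩
    let π := S.rangeRestrict
    obtain ⟨T₂, hT₂, hM₂T₂⟩ := h₂ (N.map π) ⟨c, hc, fun x ↦ by
      obtain ⟨x, rfl⟩ := S.surjective_rangeRestrict x
      exact ⟨c • x, hcN x, map_nsmul _ _ _⟩⟩
    have := free_submodule (N.map π)
    obtain ⟨t, ht⟩ := exists_equivariant_section (X := N) (Y := N.map π)
      (π.submoduleMap N) (π.submoduleMap_surjective N)
    have ht' (y : N.map π) : π (t y) = Fintype.card H • (y : S.range) :=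
      congrArg Subtype.val (ht y)
    let r : L →ₗ[MonoidAlgebra ℤ H] S.ker :=
      (Fintype.card H • LinearMap.id - s ∘ₗ π).codRestrict S.ker fun x ↦ by
        rw [← S.ker_rangeRestrict, LinearMap.mem_ker]
        simp [π, hs]
    let T : L →ₗ[MonoidAlgebra ℤ H] L :=
      S.ker.subtype ∘ₗ T₁ ∘ₗ r + N.subtype ∘ₗ t ∘ₗ (T₂ ∘ₗ π).codRestrict (N.map π) fun x ↦ hT₂ _
    refine ⟨T, fun x ↦ N.add_mem (hT₁ _) (t _).2, fun y hy ↦ ?_⟩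
    obtain ⟨z₂, hz₂⟩ := hM₂T₂ (π y) ⟨y, hy, rfl⟩
    obtain ⟨x, rfl⟩ := S.surjective_rangeRestrict z₂
    have hπker (z : S.ker) : π z = 0 := Subtype.ext z.2
    have hTπ : π (T x) = (Fintype.card H * M₂) • π y := by
      change π (T₁ (r x) + t _) = _
      rw [map_add, hπker, zero_add, ht', mul_smul, ← hz₂]
      rfl
    have hu : T x - (Fintype.card H * M₂) • y ∈ S.ker := by
      rw [← S.ker_rangeRestrict, LinearMap.mem_ker, map_sub, map_nsmul]
      exact sub_eq_zero.mpr hTπ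
    obtain ⟨z, hz⟩ := hM₁T₁ ⟨_, hu⟩
      (N.sub_mem (N.add_mem (hT₁ _) (t _).2) (N.toAddSubgroup.nsmul_mem hy _))
    have hTz : T z = (Fintype.card H * M₁) • (T x - (Fintype.card H * M₂) • y) := by
      have hr : r z = Fintype.card H • z := by
        ext
        simp [r, hπker]
      have hT₂z : (T₂ ∘ₗ π).codRestrict (N.map π) (fun x ↦ hT₂ _) (z : L) = 0 := by
        ext
        simp [hπker]
      change (T₁ (r z) : L) + (t ((T₂ ∘ₗ π).codRestrict (N.map π) (fun x ↦ hT₂ _) (z : L)) : L) = _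
      rw [hT₂z, hr, map_nsmul, hz, map_zero, ZeroMemClass.coe_zero, add_zero, smul_smul]
      rfl
    refine ⟨(Fintype.card H * M₁) • x - z, ?_⟩
    rw [map_sub, map_nsmul, hTz, smul_sub, sub_sub_cancel, smul_smul]

end

/-- there is a constant `M > 0` such that every `φ`-invariant image
subgroup `B(ℤ^m)` (with `det B ≠ 0`) contains the image `B'(ℤ^m)` of a matrix `B'`
commuting with `φ` and with `0 < |det B'| ≤ M·|det B|`. -/
theorem stmt_16 {H : Type*} [Group H] [Fintype H] {m : ℕ}
    (φ : H →* Matrix.GeneralLinearGroup (Fin m) ℤ) :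
    ∃ M : ℝ, 0 < M ∧ ∀ B : Matrix (Fin m) (Fin m) ℤ, B.det ≠ 0 →
      matRange B ∈ InvSet φ →
      ∃ B' : Matrix (Fin m) (Fin m) ℤ,
        (∀ h : H, B' * ((φ h : Matrix (Fin m) (Fin m) ℤ)) =
          ((φ h : Matrix (Fin m) (Fin m) ℤ)) * B') ∧
        matRange B' ≤ matRange B ∧
        B'.det ≠ 0 ∧ (|B'.det| : ℝ) ≤ M * (|B.det| : ℝ) := by
  classical
  let ρ : Representation ℤ H (Fin m → ℤ) :=
    (Matrix.toLinAlgEquiv' : Matrix (Fin m) (Fin m) ℤ ≃ₐ[ℤ] _).toMonoidHom.comp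
      ((Units.coeHom _).comp φ)
  have hρ (h : H) (x : Fin m → ℤ) : ρ h x = (φ h : Matrix (Fin m) (Fin m) ℤ).mulVec x := rfl
  have : @Module.Finite ℤ ρ.asModule _ _ (AddCommGroup.toIntModule _) :=
    inferInstanceAs (Module.Finite ℤ (Fin m → ℤ))
  have : @Module.Free ℤ ρ.asModule _ _ (AddCommGroup.toIntModule _) :=
    inferInstanceAs (Module.Free ℤ (Fin m → ℤ))
  obtain ⟨M, hM, hbound⟩ := exists_bound_of_finrank_le (H := H) _ ρ.asModule le_rfl
  refine ⟨(M : ℝ) ^ m, by positivity, fun B hB ⟨hfin, hinv⟩ ↦ ?_⟩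
  let N : Submodule (MonoidAlgebra ℤ H) ρ.asModule :=
    { (matRange B).toIntSubmodule with
      smul_mem' := fun a x hx ↦ by
        induction a using MonoidAlgebra.induction_linear with
        | zero => exact (zero_smul (MonoidAlgebra ℤ H) x).symm ▸ (matRange B).zero_mem
        | add a b ha hb => exact (add_smul a b x).symm ▸ (matRange B).add_mem ha hb
        | single h t =>
          rw [Representation.single_smul]
          exact (matRange B).zsmul_mem (hinv h ▸ ⟨x, hx, rfl⟩) t }
  obtain ⟨T, hTN, hMT⟩ := hbound N ⟨(matRange B).index, hfin.index_ne_zero,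
    fun x ↦ (matRange B).nsmul_index_mem x⟩
  let T' : (Fin m → ℤ) →ₗ[ℤ] (Fin m → ℤ) := T.restrictScalars ℤ
  have hT' (x : Fin m → ℤ) : (LinearMap.toMatrix' T').mulVec x = T' x :=
    LinearMap.toMatrix'_mulVec _ _
  have hcomm (h : H) (x : Fin m → ℤ) : T' (ρ h x) = ρ h (T' x) := by
    have hsmul (v : ρ.asModule) :
        MonoidAlgebra.single h (1 : ℤ) • v = ρ.asModuleEquiv.symm (ρ h (ρ.asModuleEquiv v)) :=
      (Representation.single_smul _ _ _ v).trans (one_smul _ _)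
    have hT := T.map_smul (MonoidAlgebra.single h (1 : ℤ)) (ρ.asModuleEquiv.symm x)
    rw [hsmul, hsmul] at hT
    exact hT
  have hfactor : ∃ C : Matrix (Fin m) (Fin m) ℤ, LinearMap.toMatrix' T' * C = M • B := by
    choose c hc using fun j ↦ hMT (B.col j) ⟨Pi.single j 1, by
      change B.mulVec _ = _
      simp⟩
    refine ⟨(Matrix.of c).transpose, ?_⟩
    ext i j
    exact congrFun ((hT' (c j)).trans (hc j)) i
  obtain ⟨C, hC⟩ := hfactor
  have hdet : (LinearMap.toMatrix' T').det * C.det = M ^ m * B.det := by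
    rw [← Matrix.det_mul, hC, Matrix.det_smul_of_tower]
    simp
  have hdet0 : (M : ℤ) ^ m * B.det ≠ 0 := by positivity
  refine ⟨LinearMap.toMatrix' T', fun h ↦ ?_, ?_, ?_, ?_⟩
  · refine Matrix.ext_iff_mulVec.mpr fun x ↦ ?_
    rw [← Matrix.mulVec_mulVec, ← Matrix.mulVec_mulVec, hT', hT', ← hρ, ← hρ, hcomm]
  · rintro _ ⟨x, rfl⟩
    change (LinearMap.toMatrix' T').mulVec x ∈ _
    rw [hT']
    exact hTN x
  · exact left_ne_zero_of_mul (hdet ▸ hdet0)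
  · have : |(LinearMap.toMatrix' T').det| ≤ M ^ m * |B.det| := by
      rw [← abs_of_nonneg (by positivity : (0 : ℤ) ≤ (M : ℤ) ^ m), ← abs_mul, ← hdet]
      exact Int.le_of_dvd (by rw [hdet]; positivity) ((abs_dvd_abs _ _).mpr (dvd_mul_right _ _))
    exact_mod_cast this
end
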